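/- arXiv:2004.04799 — 7 statements merged into one kernel-verified Lean document; each statement's English description precedes it below -/
import Mathlib

section
/- There exists a constant c(N) ∈ (0, 1/2), depending only on the dimension N ≥ 2, with the following property: for every Lebesgue-measurable set E ⊂ ℝ^N with 0 < |E| < ∞ whose topological boundary ∂E satisfies 0 < H^{N−1}(∂E) < ∞, one has sup_{z ∈ ℤ^N} |E ∩ (z + (0,1)^N)| ≥ c(N) · min{ (|E| / H^{N−1}(∂E))^N , 1 }. -/
open MeasureTheory Metric Set

/-- the open unit cube with corner `z`, in the sup-normed space -/
def nvCube {N : ℕ} (z : Fin N → ℤ) : Set (Fin N → ℝ) :=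
  Set.univ.pi fun i => Set.Ioo (z i : ℝ) (z i + 1)

/-- a preconnected set meeting `E` and its complement meets the frontier -/
lemma nv_inter_frontier {X : Type*} [TopologicalSpace X] {t : Set X}
    (ht : IsPreconnected t) (E : Set X) (h1 : (t ∩ E).Nonempty) (h2 : (t ∩ Eᶜ).Nonempty) :
    (t ∩ frontier E).Nonempty := by
  by_contra hcon
  have hno : ∀ x ∈ t, x ∉ frontier E := fun x hx hxf => hcon ⟨x, hx, hxf⟩
  have hA : ∀ x ∈ t, x ∈ E → x ∈ interior E := fun x hx hxE => by
    by_contra h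
    exact hno x hx ⟨subset_closure hxE, h⟩
  have hB : ∀ x ∈ t, x ∈ Eᶜ → x ∈ interior Eᶜ := fun x hx hxE => by
    by_contra h
    refine hno x hx ?_
    rw [← frontier_compl]
    exact ⟨subset_closure hxE, h⟩
  obtain ⟨x, _, hx1, hx2⟩ := ht _ _ isOpen_interior isOpen_interior
    (fun x hx => (em (x ∈ E)).imp (hA x hx) (hB x hx))
    (h1.mono fun x hx => ⟨hx.1, hA x hx.1 hx.2⟩) (h2.mono fun x hx => ⟨hx.1, hB x hx.1 hx.2⟩)
  exact interior_subset hx2 (interior_subset hx1)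

/-- measure of a projection along one axis -/
lemma nv_proj {n : ℕ} (z : Fin (n + 1) → ℤ) (E : Set (Fin (n + 1) → ℝ)) (hE : MeasurableSet E)
    (i : Fin (n + 1)) :
    (Measure.pi fun j : Fin n => (volume : Measure ℝ).restrict
      (Set.Ioo (z (i.succAbove j) : ℝ) (z (i.succAbove j) + 1)))
      ((fun x : Fin (n + 1) → ℝ => (i.removeNth x : Fin n → ℝ)) '' (E ∩ nvCube z)) ≤
    volume (E ∩ nvCube z) + μH[(n : ℝ)] (frontier E ∩ nvCube z) := by
  set ν : Fin (n + 1) → Measure ℝ := fun j =>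
    (volume : Measure ℝ).restrict (Set.Ioo (z j : ℝ) (z j + 1)) with hν
  set r : (Fin (n + 1) → ℝ) → (Fin n → ℝ) := fun x => i.removeNth x with hr
  have hpi : Measure.pi ν = volume.restrict (nvCube z) := by
    rw [hν, ← Measure.restrict_pi_pi]; rfl
  have hpi' : (Measure.pi fun j : Fin n => ν (i.succAbove j)) ≤ volume := by
    rw [hν, ← Measure.restrict_pi_pi]; exact Measure.restrict_le_self
  change (Measure.pi fun j : Fin n => ν (i.succAbove j)) (r '' (E ∩ nvCube z)) ≤ _
  set e := MeasurableEquiv.piFinSuccAbove (fun _ : Fin (n + 1) => ℝ) i with he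
  have hmp := measurePreserving_piFinSuccAbove ν i
  let g : (Fin n → ℝ) → ENNReal := fun y => ν i ((fun t => (t, y)) ⁻¹' (e.symm ⁻¹' E))
  have hms : MeasurableSet (e.symm ⁻¹' E) := e.symm.measurable hE
  have hg : Measurable g := measurable_measure_prodMk_right hms
  have hint : ∫⁻ y, g y ∂(Measure.pi fun j : Fin n => ν (i.succAbove j))
      = volume (E ∩ nvCube z) := by
    rw [← Measure.prod_apply_symm hms, ← hmp.measure_preimage_equiv]
    have : (e ⁻¹' (e.symm ⁻¹' E)) = E := by ext x; simp
    rw [show (MeasurableEquiv.piFinSuccAbove (fun _ : Fin (n + 1) => ℝ) i) ⁻¹' (e.symm ⁻¹' E) = E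
      from this, hpi, Measure.restrict_apply hE]
  have hsub : r '' (E ∩ nvCube z) ⊆ {y | 1 ≤ g y} ∪ r '' (frontier E ∩ nvCube z) := by
    rintro _ ⟨x, ⟨hxE, hxQ⟩, rfl⟩
    by_cases hb : r x ∈ r '' (frontier E ∩ nvCube z)
    · exact Or.inr hb
    left
    let φ : ℝ → (Fin (n + 1) → ℝ) := fun t => i.insertNth t (r x)
    have hφ : Continuous φ := Continuous.finInsertNth i continuous_id continuous_const
    have hxφ : φ (x i) = x := Fin.insertNth_self_removeNth i x
    have hQ : ∀ t ∈ Set.Ioo (z i : ℝ) (z i + 1), φ t ∈ nvCube z := by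
      intro t ht j _
      rcases Fin.eq_self_or_eq_succAbove i j with rfl | ⟨k, rfl⟩
      · simpa [φ] using ht
      · simpa [φ, hr, Fin.removeNth] using hxQ (i.succAbove k) (mem_univ _)
    have hJ : ∀ t ∈ Set.Ioo (z i : ℝ) (z i + 1), φ t ∈ E := by
      by_contra hcon
      push Not at hcon
      obtain ⟨t, ht, htE⟩ := hcon
      have hpc : IsPreconnected (φ '' Set.Ioo (z i : ℝ) (z i + 1)) :=
        isPreconnected_Ioo.image _ hφ.continuousOn
      obtain ⟨w, ⟨s, hs, rfl⟩, hw⟩ := nv_inter_frontier hpc E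
        ⟨x, ⟨x i, hxQ i (mem_univ _), hxφ⟩, hxE⟩ ⟨φ t, ⟨t, ht, rfl⟩, htE⟩
      exact hb ⟨φ s, ⟨hw, hQ s hs⟩, Fin.removeNth_insertNth (α := fun _ => ℝ) i s (r x)⟩
    show 1 ≤ g (r x)
    have h1 : ν i (Set.Ioo (z i : ℝ) (z i + 1)) = 1 := by
      simp [hν]
    rw [← h1]
    exact measure_mono fun t ht => hJ t ht
  have hlip : LipschitzWith 1 r := by
    refine LipschitzWith.of_edist_le fun x y => ?_
    rw [edist_pi_le_iff]
    intro j
    exact edist_le_pi_edist x y (i.succAbove j)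
  calc _ ≤ (Measure.pi fun j : Fin n => ν (i.succAbove j)) {y | 1 ≤ g y}
        + (Measure.pi fun j : Fin n => ν (i.succAbove j)) (r '' (frontier E ∩ nvCube z)) :=
        (measure_mono hsub).trans (measure_union_le _ _)
    _ ≤ _ := by
      gcongr
      · rw [← hint]
        simpa using mul_meas_ge_le_lintegral (μ := Measure.pi fun j : Fin n => ν (i.succAbove j)) hg 1
      · refine (hpi' _).trans ?_
        have := hlip.hausdorffMeasure_image_le (d := n) (by positivity) (frontier E ∩ nvCube z)
        have h2 : (μH[(n : ℝ)] : Measure (Fin n → ℝ)) = volume := by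
          simpa using hausdorffMeasure_pi_real (ι := Fin n)
        rw [h2] at this
        simpa using this

lemma nv_cube {n : ℕ} (hn : 1 ≤ n) (z : Fin (n + 1) → ℤ) (E : Set (Fin (n + 1) → ℝ))
    (hE : MeasurableSet E) :
    volume (E ∩ nvCube z) ≤ (((n + 1 : ℕ) : ENNReal) * (volume (E ∩ nvCube z)
      + μH[(n : ℝ)] (frontier E ∩ nvCube z))) ^ (((n : ℝ) + 1) / n) := by
  set ν : Fin (n + 1) → Measure ℝ := fun j =>
    (volume : Measure ℝ).restrict (Set.Ioo (z j : ℝ) (z j + 1)) with hν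
  have hprob : ∀ j, IsProbabilityMeasure (ν j) := fun j => ⟨by simp [hν]⟩
  have hpi : Measure.pi ν = volume.restrict (nvCube z) := by
    rw [hν, ← Measure.restrict_pi_pi]; rfl
  let r : Fin (n + 1) → (Fin (n + 1) → ℝ) → (Fin n → ℝ) := fun i x => i.removeNth x
  let ν' : Fin (n + 1) → Measure (Fin n → ℝ) := fun i => Measure.pi fun j => ν (i.succAbove j)
  let F : Fin (n + 1) → Set (Fin n → ℝ) := fun i => toMeasurable (ν' i) (r i '' (E ∩ nvCube z))
  have hF : ∀ i, MeasurableSet (F i) := fun i => measurableSet_toMeasurable _ _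
  have hr : ∀ i, Measurable (r i) := fun i =>
    measurable_pi_lambda _ fun j => measurable_pi_apply _
  have hmp : ∀ i, MeasurePreserving (r i) (Measure.pi ν) (ν' i) := fun i =>
    measurePreserving_snd.comp (measurePreserving_piFinSuccAbove ν i)
  let f : (Fin (n + 1) → ℝ) → ENNReal := fun x => ∑ i, (F i).indicator 1 (r i x)
  have hfi : ∀ i, Measurable fun x => (F i).indicator (1 : (Fin n → ℝ) → ENNReal) (r i x) :=
    fun i => (measurable_one.indicator (hF i)).comp (hr i)
  have hf : Measurable f := Finset.measurable_sum _ fun i _ => hfi i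
  have hn0 : (0 : ℝ) < n := by exact_mod_cast hn
  have hconj : ((Fintype.card (Fin (n + 1)) : ℕ) : ℝ).HolderConjugate (((n : ℝ) + 1) / n) := by
    rw [Real.holderConjugate_iff]
    simp only [Fintype.card_fin]
    push_cast
    constructor
    · linarith
    · field_simp
      ring
  have key := lintegral_prod_lintegral_pow_le ν hconj hf
  have hfint : ∫⁻ x, f x ∂Measure.pi ν ≤ ((n + 1 : ℕ) : ENNReal) * (volume (E ∩ nvCube z)
      + μH[(n : ℝ)] (frontier E ∩ nvCube z)) := by
    rw [lintegral_finsetSum _ fun i _ => hfi i]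
    calc _ ≤ ∑ i : Fin (n + 1), (volume (E ∩ nvCube z)
      + μH[(n : ℝ)] (frontier E ∩ nvCube z)) := by
          refine Finset.sum_le_sum fun i _ => ?_
          rw [(hmp i).lintegral_comp (measurable_one.indicator (hF i)), lintegral_indicator_one (hF i),
            measure_toMeasurable]
          exact nv_proj z E hE i
      _ = _ := by simp [mul_add]
  refine le_trans ?_ (key.trans (ENNReal.rpow_le_rpow hfint (by positivity)))
  have hEQ : volume (E ∩ nvCube z) = ∫⁻ x, (E ∩ nvCube z).indicator 1 x ∂Measure.pi ν := by
    have hQ : MeasurableSet (nvCube z) := MeasurableSet.univ_pi fun i => measurableSet_Ioo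
    rw [lintegral_indicator_one (hE.inter hQ), hpi, Measure.restrict_apply (hE.inter hQ), inter_assoc,
      inter_self]
  rw [hEQ]
  refine lintegral_mono fun x => ?_
  by_cases hx : x ∈ E ∩ nvCube z
  · rw [indicator_of_mem hx]
    refine Finset.one_le_prod' fun i _ => ?_
    refine ENNReal.one_le_rpow ?_ ?_
    · have : ∀ t, (1 : ENNReal) ≤ f (Function.update x i t) := by
        intro t
        have h1 : (F i).indicator (1 : (Fin n → ℝ) → ENNReal) (r i (Function.update x i t)) = 1 := by
          have : r i (Function.update x i t) = r i x := Fin.removeNth_update i t x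
          rw [this, indicator_of_mem]
          · rfl
          · exact subset_toMeasurable _ _ ⟨x, hx, rfl⟩
        rw [← h1]
        exact Finset.single_le_sum (f := fun k => (F k).indicator (1 : (Fin n → ℝ) → ENNReal)
          (r k (Function.update x i t))) (fun _ _ => zero_le) (Finset.mem_univ i)
      calc (1 : ENNReal) = ∫⁻ t, 1 ∂ν i := by simp
        _ ≤ _ := lintegral_mono this
    · simp only [Fintype.card_fin]; push_cast; simp; omega
  · rw [indicator_of_notMem hx]; exact zero_le

/-- the algebraic absorption step -/
lemma nv_absorb {n : ℕ} (hn : 1 ≤ n) {a h s : ENNReal}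
    (H : a ≤ (((n + 1 : ℕ) : ENNReal) * (a + h)) ^ (((n : ℝ) + 1) / n))
    (has : a ≤ s) (hs : s ≤ ((2 * (n + 1 : ℕ) : ENNReal) ^ (n + 1))⁻¹) :
    a ≤ s ^ (1 / ((n : ℝ) + 1)) * (2 * (n + 1 : ℕ) : ENNReal) * h := by
  have hn0 : (0 : ℝ) < n := by exact_mod_cast hn
  set M : ENNReal := ((n + 1 : ℕ) : ENNReal) with hM
  have hM0 : M ≠ 0 := by simp [hM]
  have hMt : M ≠ ⊤ := by simp [hM]
  set b : ENNReal := a ^ ((n : ℝ) / (n + 1)) with hb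
  have hat : a ≠ ⊤ := by
    refine ne_top_of_le_ne_top ?_ (has.trans hs)
    simp [hM0]
  have hbt : b ≠ ⊤ := ENNReal.rpow_ne_top_of_nonneg (by positivity) hat
  have hab : a = a ^ (1 / ((n : ℝ) + 1)) * b := by
    rw [hb, ← ENNReal.rpow_add_of_nonneg _ _ (by positivity) (by positivity)]
    rw [show 1 / ((n : ℝ) + 1) + n / (n + 1) = 1 by field_simp; ring, ENNReal.rpow_one]
  have h1 : b ≤ M * (a + h) := by
    have := ENNReal.rpow_le_rpow H (z := (n : ℝ) / (n + 1)) (by positivity)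
    rwa [← ENNReal.rpow_mul, show ((n : ℝ) + 1) / n * (n / (n + 1)) = 1 by field_simp,
      ENNReal.rpow_one] at this
  have h2 : a ^ (1 / ((n : ℝ) + 1)) ≤ (2 * M)⁻¹ := by
    have := ENNReal.rpow_le_rpow (has.trans hs) (z := 1 / ((n : ℝ) + 1)) (by positivity)
    rwa [ENNReal.inv_pow, ← ENNReal.rpow_natCast, ← ENNReal.rpow_mul, show ((n + 1 : ℕ) : ℝ) * (1 / ((n : ℝ) + 1)) = 1 by
      push_cast; field_simp, ENNReal.rpow_one] at this
  have h3 : M * a ≤ b / 2 := by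
    calc M * a = M * (a ^ (1 / ((n : ℝ) + 1)) * b) := by rw [← hab]
      _ ≤ M * ((2 * M)⁻¹ * b) := by gcongr
      _ = b / 2 := by
        rw [ENNReal.mul_inv (by simp) (by simp), div_eq_mul_inv]
        calc M * (2⁻¹ * M⁻¹ * b) = (M * M⁻¹) * (b * 2⁻¹) := by ring
          _ = _ := by rw [ENNReal.mul_inv_cancel hM0 hMt, one_mul]
  have h4 : b / 2 ≤ M * h := by
    have h5 : b / 2 + b / 2 ≤ b / 2 + M * h := by
      rw [ENNReal.add_halves]
      calc b ≤ M * a + M * h := by rw [← mul_add]; exact h1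
        _ ≤ _ := by gcongr
    exact (ENNReal.add_le_add_iff_left (ENNReal.div_ne_top hbt (by simp))).1 h5
  have h6 : b ≤ 2 * M * h := by
    calc b = b / 2 + b / 2 := (ENNReal.add_halves b).symm
      _ ≤ M * h + M * h := by gcongr
      _ = _ := by ring
  calc a = a ^ (1 / ((n : ℝ) + 1)) * b := hab
    _ ≤ s ^ (1 / ((n : ℝ) + 1)) * (2 * M * h) := by gcongr
    _ = _ := by ring

/-- the open unit cube in Euclidean space -/
def nvECube {N : ℕ} (z : Fin N → ℤ) : Set (EuclideanSpace ℝ (Fin N)) :=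
  {x : EuclideanSpace ℝ (Fin N) | ∀ i, x i - (z i : ℝ) ∈ Set.Ioo (0 : ℝ) 1}

lemma nvECube_eq {N : ℕ} (z : Fin N → ℤ) :
    nvECube z = (WithLp.ofLp : EuclideanSpace ℝ (Fin N) → (Fin N → ℝ)) ⁻¹' nvCube z := by
  ext x
  simp only [nvECube, nvCube, mem_ofPred_eq, mem_preimage, mem_pi, mem_univ, true_imp_iff, mem_Ioo]
  refine forall_congr' fun i => and_congr ?_ ?_ <;> constructor <;> intro h <;> linarith

lemma nv_euclid {n : ℕ} (hn : 1 ≤ n) (z : Fin (n + 1) → ℤ)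
    (E : Set (EuclideanSpace ℝ (Fin (n + 1)))) (hE : MeasurableSet E) :
    volume (E ∩ nvECube z) ≤ (((n + 1 : ℕ) : ENNReal) * (volume (E ∩ nvECube z)
      + μH[(n : ℝ)] (frontier E ∩ nvECube z))) ^ (((n : ℝ) + 1) / n) := by
  let T : (Fin (n + 1) → ℝ) → EuclideanSpace ℝ (Fin (n + 1)) := WithLp.toLp 2
  let O : EuclideanSpace ℝ (Fin (n + 1)) → (Fin (n + 1) → ℝ) := WithLp.ofLp
  have hT : MeasurePreserving T volume volume := PiLp.volume_preserving_toLp _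
  have hQ : MeasurableSet (nvCube z) := MeasurableSet.univ_pi fun i => measurableSet_Ioo
  have hO : Measurable O := (PiLp.volume_preserving_ofLp _).measurable
  have hQE : MeasurableSet (nvECube z) := by rw [nvECube_eq]; exact hO hQ
  have hE' : MeasurableSet (T ⁻¹' E) := hT.measurable hE
  have hpre : T ⁻¹' (nvECube z) = nvCube z := by rw [nvECube_eq]; rfl
  have hvol : volume (T ⁻¹' E ∩ nvCube z) = volume (E ∩ nvECube z) := by
    rw [← hpre, ← preimage_inter, hT.measure_preimage (hE.inter hQE).nullMeasurableSet]
  have hfr : frontier (T ⁻¹' E) = T ⁻¹' frontier E :=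
    ((PiLp.homeomorph 2 (fun _ : Fin (n + 1) => ℝ)).symm.preimage_frontier E).symm
  have hsub : frontier (T ⁻¹' E) ∩ nvCube z ⊆ O '' (frontier E ∩ nvECube z) := by
    intro x hx
    rw [hfr, ← hpre] at hx
    exact ⟨T x, hx, rfl⟩
  have hH : μH[(n : ℝ)] (frontier (T ⁻¹' E) ∩ nvCube z) ≤ μH[(n : ℝ)] (frontier E ∩ nvECube z) := by
    refine (measure_mono hsub).trans ?_
    have := (PiLp.lipschitzWith_ofLp 2 (fun _ : Fin (n + 1) => ℝ)).hausdorffMeasure_image_le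
      (d := n) (by positivity) (frontier E ∩ nvECube z)
    simpa using this
  have := nv_cube hn z (T ⁻¹' E) hE'
  rw [hvol] at this
  refine this.trans ?_
  gcongr

lemma nv_cover {N : ℕ} (E : Set (EuclideanSpace ℝ (Fin N))) (hE : MeasurableSet E) :
    volume E ≤ ∑' z : Fin N → ℤ, volume (E ∩ nvECube z) := by
  let O : EuclideanSpace ℝ (Fin N) → (Fin N → ℝ) := WithLp.ofLp
  have hO : MeasurePreserving O volume volume := PiLp.volume_preserving_ofLp _
  let C : (Fin N → ℤ) → Set (Fin N → ℝ) := fun z => Set.univ.pi fun i => Set.Ico (z i : ℝ) (z i + 1)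
  have hsub : E ⊆ ⋃ z, E ∩ O ⁻¹' C z := by
    intro x hx
    refine mem_iUnion.2 ⟨fun i => ⌊x i⌋, hx, fun i _ => ⟨Int.floor_le _, Int.lt_floor_add_one _⟩⟩
  refine (measure_mono hsub).trans ((measure_iUnion_le _).trans (ENNReal.tsum_le_tsum fun z => ?_))
  refine le_of_eq (measure_congr ?_)
  have h1 : C z =ᵐ[volume] nvCube z :=
    (Measure.univ_pi_Ico_ae_eq_Icc (μ := fun _ : Fin N => (volume : Measure ℝ))).trans
      (Measure.univ_pi_Ioo_ae_eq_Icc (μ := fun _ : Fin N => (volume : Measure ℝ))).symm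
  rw [nvECube_eq]
  exact (Filter.EventuallyEq.refl _ _).inter (hO.quasiMeasurePreserving.preimage_ae_eq h1)

lemma nv_disj {N : ℕ} : Pairwise (Function.onFun Disjoint (nvECube (N := N))) := by
  intro z w hzw
  refine Set.disjoint_left.2 fun x hx hy => hzw ?_
  funext i
  have h1 := hx i
  have h2 := hy i
  simp only [mem_Ioo] at h1 h2
  have a : (z i : ℝ) < w i + 1 := by linarith
  have b : (w i : ℝ) < z i + 1 := by linarith
  have a' : z i < w i + 1 := by exact_mod_cast a
  have b' : w i < z i + 1 := by exact_mod_cast b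
  omega

/-- Lemma 2.1 (non-vanishing): a set of finite measure and finite boundary Hausdorff
measure puts a definite amount of mass in some unit cube of the integer lattice. -/
theorem nonvanishing_lemma (N : ℕ) (hN : 2 ≤ N) :
    ∃ c : ℝ, 0 < c ∧ c < 1 / 2 ∧
      ∀ E : Set (EuclideanSpace ℝ (Fin N)), MeasurableSet E →
        0 < volume E → volume E < ⊤ →
        0 < μH[(N : ℝ) - 1] (frontier E) → μH[(N : ℝ) - 1] (frontier E) < ⊤ →
        ENNReal.ofReal c * min ((volume E / μH[(N : ℝ) - 1] (frontier E)) ^ N) 1 ≤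
          ⨆ z : Fin N → ℤ,
            volume (E ∩ {x : EuclideanSpace ℝ (Fin N) |
              ∀ i, x i - (z i : ℝ) ∈ Set.Ioo (0 : ℝ) 1}) := by
  obtain ⟨n, rfl⟩ : ∃ n, N = n + 1 := ⟨N - 1, by omega⟩
  have hn : 1 ≤ n := by omega
  have hc0 : (0 : ℝ) < (2 * ((n + 1 : ℕ) : ℝ)) ^ (n + 1) := by positivity
  refine ⟨((2 * ((n + 1 : ℕ) : ℝ)) ^ (n + 1))⁻¹, inv_pos.2 hc0, ?_, ?_⟩
  · rw [one_div]
    have hN' : (2 : ℝ) ≤ ((n + 1 : ℕ) : ℝ) := by exact_mod_cast hN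
    refine inv_strictAnti₀ (by norm_num) ?_
    calc (2 : ℝ) < 2 * ((n + 1 : ℕ) : ℝ) := by linarith
      _ ≤ _ := le_self_pow₀ (by linarith) (by omega)
  intro E hE hV0 hVt hP0 hPt
  rw [show (((n + 1 : ℕ) : ℝ) - 1) = n by push_cast; ring] at *
  set V := volume E
  set P := μH[(n : ℝ)] (frontier E) with hP
  set K : ENNReal := 2 * ((n + 1 : ℕ) : ENNReal) with hK
  have hK0 : K ≠ 0 := by simp [hK]
  have hKt : K ≠ ⊤ := by simp [hK, ENNReal.mul_eq_top]
  have hc : ENNReal.ofReal ((2 * ((n + 1 : ℕ) : ℝ)) ^ (n + 1))⁻¹ = (K ^ (n + 1))⁻¹ := by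
    rw [ENNReal.ofReal_inv_of_pos hc0, ENNReal.ofReal_pow (by positivity),
      ENNReal.ofReal_mul (by norm_num), ENNReal.ofReal_natCast, ENNReal.ofReal_ofNat]
  rw [hc]
  change _ ≤ ⨆ z : Fin (n + 1) → ℤ, volume (E ∩ nvECube z)
  set s := ⨆ z : Fin (n + 1) → ℤ, volume (E ∩ nvECube z) with hs
  by_cases hsK : s ≤ (K ^ (n + 1))⁻¹
  swap
  · calc _ ≤ (K ^ (n + 1))⁻¹ * 1 := by gcongr; exact min_le_right _ _
      _ ≤ s := by rw [mul_one]; exact (not_le.1 hsK).le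
  have hO : Measurable (WithLp.ofLp : EuclideanSpace ℝ (Fin (n + 1)) → _) :=
    (PiLp.volume_preserving_ofLp _).measurable
  have hQE : ∀ z : Fin (n + 1) → ℤ, MeasurableSet (nvECube z) := fun z => by
    rw [nvECube_eq]; exact hO (MeasurableSet.univ_pi fun i => measurableSet_Ioo)
  have hsum : ∑' z : Fin (n + 1) → ℤ, μH[(n : ℝ)] (frontier E ∩ nvECube z) ≤ P := by
    refine (tsum_meas_le_meas_iUnion_of_disjoint _
      (fun z => isClosed_frontier.measurableSet.inter (hQE z)) ?_).trans
      (measure_mono (iUnion_subset fun z => inter_subset_left))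
    exact fun z w hzw => (nv_disj hzw).mono inter_subset_right inter_subset_right
  have hVP : V ≤ s ^ (1 / ((n : ℝ) + 1)) * K * P := by
    calc V ≤ ∑' z : Fin (n + 1) → ℤ, volume (E ∩ nvECube z) := nv_cover E hE
      _ ≤ ∑' z : Fin (n + 1) → ℤ, s ^ (1 / ((n : ℝ) + 1)) * K *
          μH[(n : ℝ)] (frontier E ∩ nvECube z) := ENNReal.tsum_le_tsum fun z =>
            nv_absorb hn (nv_euclid hn z E hE)
              (le_iSup (fun z : Fin (n + 1) → ℤ => volume (E ∩ nvECube z)) z) hsK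
      _ = s ^ (1 / ((n : ℝ) + 1)) * K * ∑' z : Fin (n + 1) → ℤ,
          μH[(n : ℝ)] (frontier E ∩ nvECube z) := ENNReal.tsum_mul_left
      _ ≤ _ := by gcongr
  have hdiv : V / P ≤ s ^ (1 / ((n : ℝ) + 1)) * K := ENNReal.div_le_of_le_mul hVP
  calc _ ≤ (K ^ (n + 1))⁻¹ * (s ^ (1 / ((n : ℝ) + 1)) * K) ^ (n + 1) := by
        gcongr
        exact (min_le_left _ _).trans (by gcongr)
    _ = ((K ^ (n + 1))⁻¹ * K ^ (n + 1)) * (s ^ (1 / ((n : ℝ) + 1))) ^ (n + 1) := by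
        rw [mul_pow]; ring
    _ = s := by
        rw [ENNReal.inv_mul_cancel (pow_ne_zero _ hK0) (ENNReal.pow_ne_top hKt), one_mul,
          ← ENNReal.rpow_natCast, ← ENNReal.rpow_mul]
        rw [show 1 / ((n : ℝ) + 1) * ((n + 1 : ℕ) : ℝ) = 1 by push_cast; field_simp,
          ENNReal.rpow_one]
    _ ≤ s := le_rfl
end

section
/- Let N ≥ 2 and μ > 0. There exist δ̄ ∈ (0, 1/2) and a constant C > 0, depending only on N and μ, with the following property: for every pair of functions f₁, f₂ : ∂B^{(μ)} → ℝ such that, for i = 1,2, ‖f_i‖_∞ ≤ δ̄, f_i is δ̄-Lipschitz with respect to the Euclidean distance, and |E_{f_i,μ}| = μ, one has |bar(E_{f₁,μ}) − bar(E_{f₂,μ})| ≤ C·√(D(E_{f₁,μ}, E_{f₂,μ})). -/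
open MeasureTheory Metric Set

noncomputable section

/-- The Lebesgue measure `ω_N` of the unit ball of `ℝ^N`. -/
def ballVolume (N : ℕ) : ℝ :=
  (volume (ball (0 : EuclideanSpace ℝ (Fin N)) 1)).toReal

/-- The radius `r(m) = (m/ω_N)^{1/N}` of the ball of volume `m` centered at the origin. -/
def rad (N : ℕ) (m : ℝ) : ℝ := (m / ballVolume N) ^ ((1 : ℝ) / (N : ℝ))

/-- The radially parametrized set
`E_{f,m} = { t • x : x ∈ ∂B^{(m)}, 0 ≤ t ≤ 1 + f x }`. -/
def radSet (N : ℕ) (m : ℝ) (f : EuclideanSpace ℝ (Fin N) → ℝ) :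
    Set (EuclideanSpace ℝ (Fin N)) :=
  {y | ∃ x ∈ sphere (0 : EuclideanSpace ℝ (Fin N)) (rad N m),
    ∃ t : ℝ, 0 ≤ t ∧ t ≤ 1 + f x ∧ y = t • x}

/-- The dissipation `D(F, E) = ∫_{E Δ F} dist(x, ∂E) dx`. -/
def dissip (N : ℕ) (F E : Set (EuclideanSpace ℝ (Fin N))) : ℝ :=
  ∫ x in symmDiff E F, infDist x (frontier E)


/-- The barycenter `bar(E) = |E|⁻¹ ∫_E x dx` of a set `E`. -/
def bary (N : ℕ) (E : Set (EuclideanSpace ℝ (Fin N))) : EuclideanSpace ℝ (Fin N) :=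
  ((volume E).toReal)⁻¹ • ∫ x in E, x

/-- Gauge function of the radial set. -/
def gauge1 {N : ℕ} (r : ℝ) (f : EuclideanSpace ℝ (Fin N) → ℝ)
    (x : EuclideanSpace ℝ (Fin N)) : ℝ := ‖x‖ / (1 + f ((r / ‖x‖) • x))

lemma proj_mem {N : ℕ} {r : ℝ} (hr : 0 < r) {x : EuclideanSpace ℝ (Fin N)} (hx : x ≠ 0) :
    (r / ‖x‖) • x ∈ sphere (0 : EuclideanSpace ℝ (Fin N)) r := by
  have : 0 < ‖x‖ := norm_pos_iff.2 hx
  rw [mem_sphere_zero_iff_norm, norm_smul, Real.norm_of_nonneg (by positivity)]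
  field_simp

lemma rad_pos (N : ℕ) (m : ℝ) (hm : 0 < m) : 0 < rad N m := by
  unfold rad ballVolume
  apply Real.rpow_pos_of_pos
  apply div_pos hm
  apply ENNReal.toReal_pos (measure_ball_pos _ _ one_pos).ne' measure_ball_lt_top.ne

lemma gauge1_lip {N : ℕ} {r : ℝ} (hr : 0 < r) {f : EuclideanSpace ℝ (Fin N) → ℝ}
    (hf : ∀ x ∈ sphere (0 : EuclideanSpace ℝ (Fin N)) r, |f x| ≤ 1 / 4)
    (hL : LipschitzOnWith (Real.toNNReal (1 / 4)) f (sphere 0 r))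
    (x y : EuclideanSpace ℝ (Fin N)) :
    |gauge1 r f x - gauge1 r f y| ≤ (2 + 2 * r) * ‖x - y‖ := by
  have key0 : ∀ z : EuclideanSpace ℝ (Fin N), |gauge1 r f z| ≤ (2 + 2 * r) * ‖z‖ := by
    intro z
    by_cases hz : z = 0
    · simp [hz, gauge1]
    have h1 := abs_le.1 (hf _ (proj_mem hr hz))
    have hp : 0 < ‖z‖ := norm_pos_iff.2 hz
    unfold gauge1
    rw [abs_of_nonneg (div_nonneg hp.le (by linarith)), div_le_iff₀ (by linarith)]
    have : 0 < r * ‖z‖ := by positivity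
    nlinarith
  by_cases hx : x = 0
  · have : gauge1 r f x = 0 := by simp [hx, gauge1]
    rw [this, hx]; simpa using key0 y
  by_cases hy : y = 0
  · have : gauge1 r f y = 0 := by simp [hy, gauge1]
    rw [this, hy]; simpa using key0 x
  have hxp : 0 < ‖x‖ := norm_pos_iff.2 hx
  have hyp : 0 < ‖y‖ := norm_pos_iff.2 hy
  have h1 := abs_le.1 (hf _ (proj_mem hr hx))
  have h2 := abs_le.1 (hf _ (proj_mem hr hy))
  have h3 := hL.dist_le_mul _ (proj_mem hr hx) _ (proj_mem hr hy)
  rw [Real.coe_toNNReal _ (by norm_num), dist_eq_norm, dist_eq_norm, Real.norm_eq_abs] at h3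
  unfold gauge1
  generalize f ((r / ‖x‖) • x) = a at *
  generalize f ((r / ‖y‖) • y) = b at *
  have hn : |‖x‖ - ‖y‖| ≤ ‖x - y‖ := abs_norm_sub_norm_le x y
  have h4 : ‖y‖ * ‖(r / ‖x‖) • x - (r / ‖y‖) • y‖ ≤ r * (2 * ‖x - y‖) := by
    have e : ‖y‖ * ‖(r / ‖x‖) • x - (r / ‖y‖) • y‖
        = r * ‖((‖y‖ - ‖x‖) / ‖x‖) • x + (x - y)‖ := by
      rw [← Real.norm_of_nonneg hyp.le, ← norm_smul, ← Real.norm_of_nonneg hr.le, ← norm_smul,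
        Real.norm_of_nonneg hyp.le, Real.norm_of_nonneg hr.le]
      congr 1
      have : x = (‖x‖ / ‖x‖) • x := by rw [div_self hxp.ne', one_smul]
      match_scalars <;> field_simp
      ring
    rw [e]
    apply mul_le_mul_of_nonneg_left _ hr.le
    refine (norm_add_le _ _).trans ?_
    rw [norm_smul, norm_div, norm_norm, div_mul_cancel₀ _ hxp.ne', Real.norm_eq_abs, abs_sub_comm]
    linarith
  have ha : 0 < 1 + a := by linarith
  have hb : 0 < 1 + b := by linarith
  have e : ‖x‖ / (1 + a) - ‖y‖ / (1 + b)
      = (‖x‖ - ‖y‖) / (1 + a) + ‖y‖ * (b - a) / ((1 + a) * (1 + b)) := by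
    field_simp; ring
  rw [e]
  refine (abs_add_le _ _).trans ?_
  have q1 : |(‖x‖ - ‖y‖) / (1 + a)| ≤ 2 * ‖x - y‖ := by
    rw [abs_div, abs_of_pos ha, div_le_iff₀ ha]
    nlinarith [norm_nonneg (x - y)]
  have q2 : |‖y‖ * (b - a) / ((1 + a) * (1 + b))| ≤ 2 * r * ‖x - y‖ := by
    rw [abs_div, abs_of_pos (mul_pos ha hb), div_le_iff₀ (mul_pos ha hb), abs_mul,
      abs_of_pos hyp, abs_sub_comm]
    have : ‖y‖ * |a - b| ≤ 1 / 4 * (r * (2 * ‖x - y‖)) := by nlinarith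
    have h5 : (1 : ℝ) / 4 ≤ (1 + a) * (1 + b) := by nlinarith
    have h6 : 0 ≤ 2 * r * ‖x - y‖ := by positivity
    nlinarith
  linarith

lemma gauge1_smul {N : ℕ} {r : ℝ} {f : EuclideanSpace ℝ (Fin N) → ℝ} {k : ℝ} (hk : 0 < k)
    (x : EuclideanSpace ℝ (Fin N)) : gauge1 r f (k • x) = k * gauge1 r f x := by
  unfold gauge1
  have : (r / ‖k • x‖) • k • x = (r / ‖x‖) • x := by
    rw [norm_smul, Real.norm_of_nonneg hk.le, smul_smul]
    congr 1
    field_simp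
  rw [this, norm_smul, Real.norm_of_nonneg hk.le, mul_div_assoc]

lemma radSet_eq {N : ℕ} (hN : 2 ≤ N) {m : ℝ} (hm : 0 < m) {f : EuclideanSpace ℝ (Fin N) → ℝ}
    (hf : ∀ x ∈ sphere (0 : EuclideanSpace ℝ (Fin N)) (rad N m), |f x| ≤ 1 / 4) :
    radSet N m f = {x | gauge1 (rad N m) f x ≤ rad N m} := by
  have hr := rad_pos N m hm
  have : Nonempty (Fin N) := ⟨⟨0, by omega⟩⟩
  ext x
  simp only [radSet, mem_ofPred_eq]
  by_cases hx : x = 0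
  · subst hx
    constructor
    · intro _; simp [gauge1, hr.le]
    · intro _
      obtain ⟨u, hu⟩ := (NormedSpace.sphere_nonempty (E := EuclideanSpace ℝ (Fin N)) (x := 0)).2 hr.le
      have := abs_le.1 (hf u hu)
      exact ⟨u, hu, 0, le_rfl, by linarith, by simp⟩
  have hxp : 0 < ‖x‖ := norm_pos_iff.2 hx
  have h1 := abs_le.1 (hf _ (proj_mem hr hx))
  constructor
  · rintro ⟨u, hu, t, ht, ht', rfl⟩
    have hun : ‖u‖ = rad N m := mem_sphere_zero_iff_norm.1 hu
    have htp : 0 < t := lt_of_le_of_ne ht (by rintro rfl; simp at hx)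
    rw [gauge1_smul htp]
    unfold gauge1
    rw [hun, div_self hr.ne', one_smul]
    have := abs_le.1 (hf u hu)
    rw [← mul_div_assoc, div_le_iff₀ (by linarith), mul_comm]
    exact mul_le_mul_of_nonneg_left ht' hr.le
  · intro h
    refine ⟨_, proj_mem hr hx, ‖x‖ / rad N m, by positivity, ?_, ?_⟩
    · unfold gauge1 at h
      rw [div_le_iff₀ (by linarith)] at h
      rw [div_le_iff₀ hr]; linarith
    · rw [smul_smul]
      have : ‖x‖ / rad N m * (rad N m / ‖x‖) = 1 := by field_simp
      rw [this, one_smul]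

lemma norm_le_gauge1 {N : ℕ} {r : ℝ} (hr : 0 < r) {f : EuclideanSpace ℝ (Fin N) → ℝ}
    (hf : ∀ x ∈ sphere (0 : EuclideanSpace ℝ (Fin N)) r, |f x| ≤ 1 / 4)
    (x : EuclideanSpace ℝ (Fin N)) : ‖x‖ ≤ 2 * gauge1 r f x := by
  by_cases hx : x = 0
  · simp [hx, gauge1]
  have hxp : 0 < ‖x‖ := norm_pos_iff.2 hx
  have h1 := abs_le.1 (hf _ (proj_mem hr hx))
  unfold gauge1
  rw [← mul_div_assoc, le_div_iff₀ (by linarith)]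
  nlinarith

lemma gauge1_cont {N : ℕ} {r : ℝ} (hr : 0 < r) {f : EuclideanSpace ℝ (Fin N) → ℝ}
    (hf : ∀ x ∈ sphere (0 : EuclideanSpace ℝ (Fin N)) r, |f x| ≤ 1 / 4)
    (hL : LipschitzOnWith (Real.toNNReal (1 / 4)) f (sphere 0 r)) :
    Continuous (gauge1 r f) := by
  have : LipschitzWith (Real.toNNReal (2 + 2 * r)) (gauge1 r f) := by
    apply LipschitzWith.of_dist_le_mul
    intro x y
    rw [Real.coe_toNNReal _ (by positivity), dist_eq_norm, dist_eq_norm]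
    exact gauge1_lip hr hf hL x y
  exact this.continuous

lemma bary_core {N : ℕ} {E F : Set (EuclideanSpace ℝ (Fin N))} {R : ℝ}
    (hE : MeasurableSet E) (hF : MeasurableSet F)
    (hER : E ⊆ closedBall 0 R) (hFR : F ⊆ closedBall 0 R) :
    ‖(∫ x in E, x) - ∫ x in F, x‖ ≤ R * volume.real (symmDiff F E) := by
  have hi : IntegrableOn (fun x : EuclideanSpace ℝ (Fin N) => x) (closedBall 0 R) :=
    continuous_id.continuousOn.integrableOn_compact (isCompact_closedBall _ _)
  have fin : ∀ S ⊆ closedBall (0 : EuclideanSpace ℝ (Fin N)) R, volume S < ⊤ := fun S hS =>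
    (measure_mono hS).trans_lt measure_closedBall_lt_top
  have hd1 : E \ F ⊆ closedBall 0 R := sdiff_subset.trans hER
  have hd2 : F \ E ⊆ closedBall 0 R := sdiff_subset.trans hFR
  have e1 := integral_inter_add_sdiff (μ := volume) hF (hi.mono_set hER)
  have e2 := integral_inter_add_sdiff (μ := volume) hE (hi.mono_set hFR)
  rw [inter_comm] at e2
  rw [← e1, ← e2, add_sub_add_left_eq_sub]
  refine (norm_sub_le _ _).trans ?_
  have b1 := norm_setIntegral_le_of_norm_le_const (f := fun x : EuclideanSpace ℝ (Fin N) => x)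
    (C := R) (fin _ hd1) (fun x hx => mem_closedBall_zero_iff.1 (hd1 hx))
  have b2 := norm_setIntegral_le_of_norm_le_const (f := fun x : EuclideanSpace ℝ (Fin N) => x)
    (C := R) (fin _ hd2) (fun x hx => mem_closedBall_zero_iff.1 (hd2 hx))
  have e : volume.real (symmDiff F E) = volume.real (F \ E) + volume.real (E \ F) := by
    rw [symmDiff_def]
    exact measureReal_union (disjoint_sdiff_sdiff) (hE.diff hF) (fin _ hd2).ne (fin _ hd1).ne
  rw [e]; linarith

lemma pow_gap (N : ℕ) {a : ℝ} (ha : 0 < a) (ha1 : a < 1) :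
    (1 + a) ^ N - (1 - a) ^ N ≤ (2 ^ N + N + 2) * a := by
  have h1 : (1 + a) ^ N ≤ 1 + (2 ^ N - 1) * a := by
    induction N with
    | zero => simp
    | succ n ih =>
      have h : (1 : ℝ) ≤ 2 ^ n := one_le_pow₀ (by norm_num)
      rw [pow_succ, pow_succ]
      have h3 : 0 ≤ (2 ^ n - 1) * (a - a * a) := mul_nonneg (by linarith) (by nlinarith)
      nlinarith [mul_le_mul_of_nonneg_right ih (by linarith : 0 ≤ 1 + a)]
  have h2 := one_add_mul_le_pow (a := -a) (by linarith) N
  rw [← sub_eq_add_neg] at h2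
  nlinarith

open scoped Pointwise in
lemma shell_vol {N : ℕ} {r m : ℝ} (hr : 0 < r) (hm : 0 < m)
    {f : EuclideanSpace ℝ (Fin N) → ℝ} (hc : Continuous (gauge1 r f))
    (hv : volume {x | gauge1 r f x ≤ r} = ENNReal.ofReal m) {a : ℝ} (ha : 0 < a) (ha1 : a < 1) :
    volume.real ({x | gauge1 r f x ≤ (1 + a) * r} \ {x | gauge1 r f x ≤ (1 - a) * r})
      ≤ m * ((2 ^ N + N + 2) * a) ∧
    volume ({x | gauge1 r f x ≤ (1 + a) * r} \ {x | gauge1 r f x ≤ (1 - a) * r}) < ⊤ := by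
  have key : ∀ k : ℝ, 0 < k →
      volume {x | gauge1 r f x ≤ k * r} = ENNReal.ofReal (k ^ N * m) := by
    intro k hk
    have e : {x | gauge1 r f x ≤ k * r} = k • {x | gauge1 r f x ≤ r} := by
      ext x
      rw [mem_smul_set_iff_inv_smul_mem₀ hk.ne']
      simp only [mem_ofPred_eq]
      rw [gauge1_smul (inv_pos.2 hk), inv_mul_le_iff₀ hk]
    rw [e, Measure.addHaar_smul, hv, finrank_euclideanSpace_fin, abs_of_pos (by positivity),
      ← ENNReal.ofReal_mul (by positivity)]
  have k1 := key (1 + a) (by linarith)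
  have k2 := key (1 - a) (by linarith)
  constructor
  · rw [measureReal_sdiff (fun x hx => ?_)
      (isClosed_le hc continuous_const).measurableSet (by rw [k1]; exact ENNReal.ofReal_ne_top)]
    · unfold Measure.real
      have p1 : 0 ≤ 1 - a := by linarith
      rw [k1, k2, ENNReal.toReal_ofReal (by positivity), ENNReal.toReal_ofReal (by positivity)]
      have := mul_le_mul_of_nonneg_left (pow_gap N ha ha1) hm.le
      linarith
    · simp only [mem_ofPred_eq] at hx ⊢
      nlinarith
  · refine (measure_mono sdiff_subset).trans_lt ?_
    rw [k1]; exact ENNReal.ofReal_lt_top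

lemma sym_core {N : ℕ} (hN : 2 ≤ N) {r m : ℝ} (hr : 0 < r) (hm : 0 < m)
    {f : EuclideanSpace ℝ (Fin N) → ℝ} {E F : Set (EuclideanSpace ℝ (Fin N))}
    (hf : ∀ x ∈ sphere (0 : EuclideanSpace ℝ (Fin N)) r, |f x| ≤ 1 / 4)
    (hL : LipschitzOnWith (Real.toNNReal (1 / 4)) f (sphere 0 r))
    (hE : E = {x | gauge1 r f x ≤ r}) (hEv : volume E = ENNReal.ofReal m)
    (hFm : MeasurableSet F) (hFR : F ⊆ closedBall 0 (2 * r))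
    (hFv : volume F = ENNReal.ofReal m) :
    volume.real (symmDiff E F) ^ 2 ≤
      (4 * (2 + 2 * r) * (2 ^ N + N + 2) * m / r) * ∫ x in symmDiff E F, infDist x (frontier E) := by
  have hc := gauge1_cont hr hf hL
  have hEm : MeasurableSet E := by
    rw [hE]; exact (isClosed_le hc continuous_const).measurableSet
  have hER : E ⊆ closedBall 0 (2 * r) := by
    rw [hE]; intro x hx
    have := norm_le_gauge1 hr hf x
    rw [mem_closedBall_zero_iff]
    simp only [mem_ofPred_eq] at hx
    linarith
  have : Nonempty (Fin N) := ⟨⟨0, by omega⟩⟩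
  have hfr : (frontier E).Nonempty := by
    rw [nonempty_frontier_iff]
    constructor
    · rw [nonempty_iff_ne_empty]
      rintro h
      rw [h, measure_empty] at hEv
      exact (ENNReal.ofReal_pos.2 hm).ne hEv
    · intro h
      obtain ⟨u, hu⟩ := (NormedSpace.sphere_nonempty (E := EuclideanSpace ℝ (Fin N)) (x := 0)
        (r := 3 * r)).2 (by positivity)
      have h1 := mem_closedBall_zero_iff.1 (hER (h ▸ mem_univ u))
      rw [mem_sphere_zero_iff_norm.1 hu] at h1
      linarith
  have hdist : ∀ x, |gauge1 r f x - r| ≤ (2 + 2 * r) * infDist x (frontier E) := by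
    intro x
    rw [← div_le_iff₀' (by positivity), le_infDist hfr]
    intro y hy
    rw [div_le_iff₀' (by positivity), dist_eq_norm]
    have hy' : gauge1 r f y = r := by
      rw [hE] at hy
      exact frontier_le_subset_eq hc continuous_const hy
    have := gauge1_lip hr hf hL x y
    rwa [hy'] at this
  have hAR : symmDiff E F ⊆ closedBall 0 (2 * r) := by
    rintro x (hx | hx)
    · exact hER hx.1
    · exact hFR hx.1
  have hAm : MeasurableSet (symmDiff E F) := hEm.symmDiff hFm
  have hAle : volume.real (symmDiff E F) ≤ 2 * m := by
    have h : symmDiff E F ⊆ E ∪ F := by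
      rintro x (hx | hx)
      · exact Or.inl hx.1
      · exact Or.inr hx.1
    have h1 : volume.real (E ∪ F) ≤ volume.real E + volume.real F := measureReal_union_le _ _
    have h2 : volume.real (symmDiff E F) ≤ volume.real (E ∪ F) :=
      measureReal_mono h (by
        refine ((measure_union_le _ _).trans_lt ?_).ne
        rw [hEv, hFv]; exact ENNReal.add_lt_top.2 ⟨ENNReal.ofReal_lt_top, ENNReal.ofReal_lt_top⟩)
    have h3 : volume.real E = m := by unfold Measure.real; rw [hEv, ENNReal.toReal_ofReal hm.le]
    have h4 : volume.real F = m := by unfold Measure.real; rw [hFv, ENNReal.toReal_ofReal hm.le]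
    linarith
  have hAfin : volume (symmDiff E F) < ⊤ :=
    (measure_mono hAR).trans_lt measure_closedBall_lt_top
  have hint : IntegrableOn (fun x => infDist x (frontier E)) (symmDiff E F) :=
    ((continuous_infDist_pt _).continuousOn.integrableOn_compact
      (isCompact_closedBall 0 (2 * r))).mono_set hAR
  set A := symmDiff E F with hA
  set D := ∫ x in A, infDist x (frontier E) with hD
  have hD0 : 0 ≤ D := integral_nonneg fun x => infDist_nonneg
  have hKpos : (2 : ℝ) ≤ 2 ^ N + N + 2 := by
    have : (0 : ℝ) ≤ 2 ^ N + N := by positivity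
    linarith
  set K : ℝ := 2 ^ N + N + 2 with hK
  have main : ∀ a : ℝ, 0 < a → a * r * (volume.real A - m * (K * a)) ≤ (2 + 2 * r) * D := by
    intro a ha
    by_cases ha1 : a < 1
    swap
    · have h1 : m * 2 ≤ m * (K * a) := by
        apply mul_le_mul_of_nonneg_left _ hm.le
        nlinarith
      have h2 : a * r * (volume.real A - m * (K * a)) ≤ 0 :=
        mul_nonpos_of_nonneg_of_nonpos (by positivity) (by linarith)
      have h3 : 0 ≤ (2 + 2 * r) * D := by positivity
      linarith
    obtain ⟨s1, s2⟩ := shell_vol hr hm hc (hE ▸ hEv) ha ha1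
    set S := {x | gauge1 r f x ≤ (1 + a) * r} \ {x | gauge1 r f x ≤ (1 - a) * r} with hS
    have hSm : MeasurableSet S := (isClosed_le hc continuous_const).measurableSet.diff
      (isClosed_le hc continuous_const).measurableSet
    have h1 : volume.real A ≤ volume.real (A \ S) + m * (K * a) := by
      have e : volume.real A = volume.real (A ∩ S) + volume.real (A \ S) :=
        (measureReal_inter_add_sdiff hSm hAfin.ne).symm
      have e' : volume.real (A ∩ S) ≤ volume.real S := measureReal_mono inter_subset_right s2.ne
      linarith
    have h2 : a * r / (2 + 2 * r) * volume.real (A \ S) ≤ D := by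
      have q1 : a * r / (2 + 2 * r) * volume.real (A \ S)
          ≤ ∫ x in A \ S, infDist x (frontier E) := by
        have : ∫ x in A \ S, (a * r / (2 + 2 * r)) = a * r / (2 + 2 * r) * volume.real (A \ S) := by
          rw [setIntegral_const, smul_eq_mul, mul_comm]
        rw [← this]
        apply setIntegral_mono_on _ (hint.mono_set sdiff_subset) (hAm.diff hSm)
        · rintro x ⟨hxA, hxS⟩
          rw [div_le_iff₀' (by positivity)]
          refine le_trans ?_ (hdist x)
          rw [le_abs]
          by_contra hcon
          push Not at hcon
          apply hxS
          constructor
          · simp only [mem_ofPred_eq]; linarith [hcon.1]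
          · simp only [mem_ofPred_eq, not_le]; linarith [hcon.2]
        · exact integrableOn_const ((measure_mono sdiff_subset).trans_lt hAfin).ne
      refine q1.trans ?_
      exact setIntegral_mono_set hint (Filter.Eventually.of_forall fun x => infDist_nonneg)
        (Filter.Eventually.of_forall sdiff_subset)
    have h3 : a * r * volume.real (A \ S) ≤ (2 + 2 * r) * D := by
      rw [div_mul_eq_mul_div, div_le_iff₀' (by positivity)] at h2
      exact h2
    refine le_trans (mul_le_mul_of_nonneg_left ?_ (by positivity)) h3
    linarith
  have hv0 : 0 ≤ volume.real A := measureReal_nonneg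
  rcases hv0.eq_or_lt with h0 | h0
  · rw [← h0]
    have : 0 ≤ 4 * (2 + 2 * r) * K * m / r * D := by positivity
    simpa using this
  · have h := main (volume.real A / (2 * m * K)) (by positivity)
    have e : volume.real A / (2 * m * K) * r
        * (volume.real A - m * (K * (volume.real A / (2 * m * K))))
        = volume.real A ^ 2 * (r / (4 * m * K)) := by
      field_simp; ring
    rw [e, ← le_div_iff₀ (by positivity)] at h
    refine h.trans (le_of_eq ?_)
    field_simp

/-- Lemma 3.6 (iii): the distance between the barycenters of two radial graphs is
controlled by the square root of their dissipation. -/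
theorem barycenter_controlled_by_dissipation
    (N : ℕ) (hN : 2 ≤ N) (μ : ℝ) (hμ : 0 < μ) :
    ∃ δ C : ℝ, 0 < δ ∧ δ < 1 / 2 ∧ 0 < C ∧
      ∀ f₁ f₂ : EuclideanSpace ℝ (Fin N) → ℝ,
        (∀ x ∈ sphere (0 : EuclideanSpace ℝ (Fin N)) (rad N μ), |f₁ x| ≤ δ) →
        (∀ x ∈ sphere (0 : EuclideanSpace ℝ (Fin N)) (rad N μ), |f₂ x| ≤ δ) →
        LipschitzOnWith (Real.toNNReal δ) f₁
          (sphere (0 : EuclideanSpace ℝ (Fin N)) (rad N μ)) →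
        LipschitzOnWith (Real.toNNReal δ) f₂
          (sphere (0 : EuclideanSpace ℝ (Fin N)) (rad N μ)) →
        volume (radSet N μ f₁) = ENNReal.ofReal μ →
        volume (radSet N μ f₂) = ENNReal.ofReal μ →
        ‖bary N (radSet N μ f₁) - bary N (radSet N μ f₂)‖ ≤
          C * Real.sqrt (dissip N (radSet N μ f₁) (radSet N μ f₂)) := by
  have hr := rad_pos N μ hμ
  set r := rad N μ with hrdef
  have hK : 0 < 4 * (2 + 2 * r) * (2 ^ N + N + 2) * μ / r := by positivity
  set K := 4 * (2 + 2 * r) * (2 ^ N + N + 2) * μ / r with hKdef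
  refine ⟨1 / 4, μ⁻¹ * (2 * r) * Real.sqrt K, by norm_num, by norm_num, by positivity, ?_⟩
  intro f₁ f₂ h1 h2 hL1 hL2 hv1 hv2
  have e1 := radSet_eq hN hμ h1
  have e2 := radSet_eq hN hμ h2
  have c1 : MeasurableSet (radSet N μ f₁) := by
    rw [e1]; exact (isClosed_le (gauge1_cont hr h1 hL1) continuous_const).measurableSet
  have c2 : MeasurableSet (radSet N μ f₂) := by
    rw [e2]; exact (isClosed_le (gauge1_cont hr h2 hL2) continuous_const).measurableSet
  have b1 : radSet N μ f₁ ⊆ closedBall 0 (2 * r) := by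
    rw [e1]; intro x hx
    have := norm_le_gauge1 hr h1 x
    rw [mem_closedBall_zero_iff]
    simp only [mem_ofPred_eq] at hx
    linarith
  have b2 : radSet N μ f₂ ⊆ closedBall 0 (2 * r) := by
    rw [e2]; intro x hx
    have := norm_le_gauge1 hr h2 x
    rw [mem_closedBall_zero_iff]
    simp only [mem_ofPred_eq] at hx
    linarith
  have S := sym_core hN hr hμ h2 hL2 e2 hv2 c1 b1 hv1
  have B := bary_core c1 c2 b1 b2
  unfold bary dissip
  rw [hv1, hv2, ENNReal.toReal_ofReal hμ.le, ← smul_sub, norm_smul, norm_inv,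
    Real.norm_of_nonneg hμ.le]
  have T := Real.le_sqrt_of_sq_le S
  rw [Real.sqrt_mul hK.le] at T
  calc _ ≤ μ⁻¹ * (2 * r * (Real.sqrt K * Real.sqrt _)) := by
        gcongr
        exact B.trans (by gcongr)
    _ = _ := by ring
end
end

section
/- Let N ≥ 2, μ > 0 and η > 0. There exists δ̄ > 0 with the following property: for every function f : ∂B^{(μ)} → ℝ with ‖f‖_∞ ≤ δ̄ which is δ̄-Lipschitz with respect to the Euclidean distance, for every x ∈ ∂B^{(μ)}, setting p₀ := (1+f(x))·x ∈ ∂E_{f,μ}, and for every point p = λ·p₀ with λ ≥ 0 and |p − p₀| ≤ 2·δ̄·r(μ), one has |p − p₀|/(1+η) ≤ dist(p, ∂E_{f,μ}) ≤ |p − p₀|. -/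
open MeasureTheory Metric Set

noncomputable section

lemma rad_pos_aux (N : ℕ) (μ : ℝ) (hμ : 0 < μ) : 0 < rad N μ := by
  unfold rad
  apply Real.rpow_pos_of_pos
  apply div_pos hμ
  unfold ballVolume
  exact ENNReal.toReal_pos (measure_ball_pos volume _ one_pos).ne' measure_ball_lt_top.ne

lemma mem_radSet_aux (N : ℕ) (μ : ℝ) (hr : 0 < rad N μ) (f : EuclideanSpace ℝ (Fin N) → ℝ)
    (y : EuclideanSpace ℝ (Fin N)) (hy : y ≠ 0) :
    y ∈ radSet N μ f ↔ ‖y‖ ≤ rad N μ * (1 + f ((rad N μ / ‖y‖) • y)) := by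
  have hn : 0 < ‖y‖ := norm_pos_iff.mpr hy
  constructor
  · rintro ⟨x, hx, t, ht, htf, rfl⟩
    have hx' : ‖x‖ = rad N μ := by simpa using hx
    have ht' : 0 < t := lt_of_le_of_ne ht (by rintro rfl; simp at hy)
    have h1 : ‖t • x‖ = t * rad N μ := by rw [norm_smul, hx', Real.norm_of_nonneg ht]
    have h2 : (rad N μ / ‖t • x‖) • t • x = x := by
      rw [h1, smul_smul]
      have : rad N μ / (t * rad N μ) * t = 1 := by field_simp
      rw [this, one_smul]
    rw [h2, h1, mul_comm]
    exact mul_le_mul_of_nonneg_left htf hr.le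
  · intro h
    refine ⟨(rad N μ / ‖y‖) • y, ?_, ‖y‖ / rad N μ, by positivity, ?_, ?_⟩
    · rw [mem_sphere_zero_iff_norm, norm_smul, Real.norm_of_nonneg (by positivity)]
      field_simp
    · rw [div_le_iff₀ hr]; linarith
    · rw [smul_smul]
      have : ‖y‖ / rad N μ * (rad N μ / ‖y‖) = 1 := by field_simp
      rw [this, one_smul]

lemma frontier_aux (N : ℕ) (μ : ℝ) (hr : 0 < rad N μ) (f : EuclideanSpace ℝ (Fin N) → ℝ)
    (hf : ∀ x ∈ sphere (0 : EuclideanSpace ℝ (Fin N)) (rad N μ), |f x| ≤ 1 / 8)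
    (hc : ContinuousOn f (sphere (0 : EuclideanSpace ℝ (Fin N)) (rad N μ)))
    (y : EuclideanSpace ℝ (Fin N)) (hy : y ∈ frontier (radSet N μ f)) :
    ∃ z ∈ sphere (0 : EuclideanSpace ℝ (Fin N)) (rad N μ), y = (1 + f z) • z := by
  have hsph : ∀ w : EuclideanSpace ℝ (Fin N), w ≠ 0 →
      (rad N μ / ‖w‖) • w ∈ sphere (0 : EuclideanSpace ℝ (Fin N)) (rad N μ) := by
    intro w hw
    have hn : 0 < ‖w‖ := norm_pos_iff.mpr hw
    rw [mem_sphere_zero_iff_norm, norm_smul, Real.norm_of_nonneg (by positivity)]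
    field_simp
  have hy0 : y ≠ 0 := by
    rintro rfl
    apply hy.2
    rw [mem_interior_iff_mem_nhds]
    filter_upwards [ball_mem_nhds (0 : EuclideanSpace ℝ (Fin N)) (half_pos hr)] with w hw
    have hw' : ‖w‖ < rad N μ / 2 := by simpa using hw
    by_cases h0 : w = 0
    · obtain ⟨v, hv⟩ : ∃ v, v ∈ frontier (radSet N μ f) := ⟨_, hy⟩
      obtain ⟨u, u', hu', -⟩ : (radSet N μ f).Nonempty :=
        closure_nonempty_iff.mp ⟨v, hv.1⟩
      have := abs_le.mp (hf u' hu')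
      exact ⟨u', hu', 0, le_rfl, by linarith, by simp [h0]⟩
    · rw [mem_radSet_aux N μ hr f w h0]
      have := abs_le.mp (hf _ (hsph w h0))
      nlinarith
  have hn : 0 < ‖y‖ := norm_pos_iff.mpr hy0
  have hcont : ContinuousAt (fun w => rad N μ * (1 + f ((rad N μ / ‖w‖) • w)) - ‖w‖) y := by
    have hon : ContinuousOn (fun w : EuclideanSpace ℝ (Fin N) => f ((rad N μ / ‖w‖) • w))
        {w | w ≠ 0} := by
      refine hc.comp (f := fun w : EuclideanSpace ℝ (Fin N) => (rad N μ / ‖w‖) • w) ?_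
        (fun w hw => hsph w hw)
      refine ContinuousOn.smul (ContinuousOn.div continuousOn_const continuous_norm.continuousOn
        (fun w hw => norm_ne_zero_iff.mpr hw)) continuousOn_id
    have := hon.continuousAt (isOpen_ne.mem_nhds hy0)
    exact (continuousAt_const.mul (continuousAt_const.add this)).sub continuous_norm.continuousAt
  have hne := isOpen_ne.mem_nhds hy0
  have key : ‖y‖ = rad N μ * (1 + f ((rad N μ / ‖y‖) • y)) := by
    rcases lt_trichotomy (rad N μ * (1 + f ((rad N μ / ‖y‖) • y)) - ‖y‖) 0 with h | h | h
    · exfalso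
      have h1 := hcont.eventually_lt continuousAt_const h
      have h2 : y ∈ interior (radSet N μ f)ᶜ := by
        rw [mem_interior_iff_mem_nhds]
        filter_upwards [h1, hne] with w hw hw0
        rw [mem_compl_iff, mem_radSet_aux N μ hr f w hw0]
        linarith
      rw [interior_compl] at h2
      exact h2 hy.1
    · linarith
    · exfalso
      have h1 := continuousAt_const.eventually_lt hcont h
      apply hy.2
      rw [mem_interior_iff_mem_nhds]
      filter_upwards [h1, hne] with w hw hw0
      rw [mem_radSet_aux N μ hr f w hw0]
      linarith
  refine ⟨_, hsph y hy0, ?_⟩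
  rw [smul_smul]
  have : (1 + f ((rad N μ / ‖y‖) • y)) * (rad N μ / ‖y‖) = 1 := by
    rw [mul_div_assoc', mul_comm, ← key, div_self hn.ne']
  rw [this, one_smul]

lemma mem_frontier_aux (N : ℕ) (μ : ℝ) (hr : 0 < rad N μ) (f : EuclideanSpace ℝ (Fin N) → ℝ)
    (x : EuclideanSpace ℝ (Fin N))
    (hx : x ∈ sphere (0 : EuclideanSpace ℝ (Fin N)) (rad N μ)) (hfx : 0 < 1 + f x) :
    (1 + f x) • x ∈ frontier (radSet N μ f) := by
  have hxn : ‖x‖ = rad N μ := by simpa using hx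
  have hx0 : x ≠ 0 := by rw [← norm_pos_iff, hxn]; exact hr
  refine ⟨subset_closure ⟨x, hx, _, hfx.le, le_rfl, rfl⟩, fun hint => ?_⟩
  rw [mem_interior_iff_mem_nhds] at hint
  have hct : Filter.Tendsto (fun t : ℝ => t • x) (nhdsWithin (1 + f x) (Ioi (1 + f x)))
      (nhds ((1 + f x) • x)) :=
    ((continuous_id.smul continuous_const).tendsto' (1 + f x) _ rfl).mono_left nhdsWithin_le_nhds
  obtain ⟨t, ht, ht'⟩ := ((hct.eventually hint).and self_mem_nhdsWithin).exists
  have ht1 : 1 + f x < t := ht'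
  have ht0 : 0 < t := hfx.trans ht1
  have h := (mem_radSet_aux N μ hr f (t • x) (smul_ne_zero ht0.ne' hx0)).mp ht
  have h1 : ‖t • x‖ = t * rad N μ := by rw [norm_smul, hxn, Real.norm_of_nonneg ht0.le]
  have h2 : (rad N μ / ‖t • x‖) • t • x = x := by
    rw [h1, smul_smul]
    have : rad N μ / (t * rad N μ) * t = 1 := by field_simp
    rw [this, one_smul]
  rw [h2, h1] at h
  nlinarith

/-- Step 1 of the proof of Lemma 3.6: for a radial graph with small Lipschitz norm, the
distance from a point on a radial ray to the boundary is comparable to the distance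
along the ray. -/
theorem radial_distance_estimate
    (N : ℕ) (hN : 2 ≤ N) (μ η : ℝ) (hμ : 0 < μ) (hη : 0 < η) :
    ∃ δ : ℝ, 0 < δ ∧
      ∀ f : EuclideanSpace ℝ (Fin N) → ℝ,
        (∀ x ∈ sphere (0 : EuclideanSpace ℝ (Fin N)) (rad N μ), |f x| ≤ δ) →
        LipschitzOnWith (Real.toNNReal δ) f
          (sphere (0 : EuclideanSpace ℝ (Fin N)) (rad N μ)) →
        ∀ x ∈ sphere (0 : EuclideanSpace ℝ (Fin N)) (rad N μ), ∀ lam : ℝ, 0 ≤ lam →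
          ‖lam • ((1 + f x) • x) - (1 + f x) • x‖ ≤ 2 * δ * rad N μ →
          ‖lam • ((1 + f x) • x) - (1 + f x) • x‖ / (1 + η) ≤
              infDist (lam • ((1 + f x) • x)) (frontier (radSet N μ f)) ∧
            infDist (lam • ((1 + f x) • x)) (frontier (radSet N μ f)) ≤
              ‖lam • ((1 + f x) • x) - (1 + f x) • x‖ := by
  have hr := rad_pos_aux N μ hμ
  set r := rad N μ with hrdef
  refine ⟨min (1 / 8) (η / (4 * r)), by positivity, ?_⟩
  set δ := min (1 / 8) (η / (4 * r)) with hδ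
  have hδ0 : 0 < δ := by positivity
  have hδ1 : δ ≤ 1 / 8 := min_le_left _ _
  have hδ2 : 4 * r * δ ≤ η := by
    have : δ ≤ η / (4 * r) := min_le_right _ _
    rw [le_div_iff₀ (by positivity)] at this
    linarith
  intro f hf hL x hx lam hlam hle
  have hxn : ‖x‖ = r := by simpa using hx
  have hfx := abs_le.mp (hf x hx)
  have hmem := mem_frontier_aux N μ hr f x hx (by linarith)
  refine ⟨?_, ?_⟩
  · rw [le_infDist ⟨_, hmem⟩]
    intro y hy
    obtain ⟨z, hz, rfl⟩ := frontier_aux N μ hr f (fun w hw => (hf w hw).trans hδ1)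
      hL.continuousOn y hy
    have hzn : ‖z‖ = r := by simpa using hz
    have hfz := abs_le.mp (hf z hz)
    have hlip : |f x - f z| ≤ δ * ‖x - z‖ := by
      have := hL.dist_le_mul x hx z hz
      rwa [Real.coe_toNNReal _ hδ0.le, Real.dist_eq, dist_eq_norm] at this
    rw [dist_eq_norm, div_le_iff₀ (by positivity)]
    rw [smul_smul] at hle ⊢
    set b := 1 + f x with hb
    set c := 1 + f z with hc
    set a := lam * b with ha
    have e1 : ‖a • x - b • x‖ = |a - b| * r := by
      rw [← sub_smul, norm_smul, hxn, Real.norm_eq_abs]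
    rw [e1] at hle ⊢
    have hab : |a - b| ≤ 2 * δ := le_of_mul_le_mul_right hle hr
    have hab' := abs_le.mp hab
    have ha4 : 1 / 4 ≤ a := by linarith
    have hc4 : 1 / 4 ≤ c := by linarith
    have hac : 1 / 16 ≤ a * c := by nlinarith
    have e2 : ‖a • x - c • z‖ ^ 2 = r ^ 2 * (a - c) ^ 2 + a * c * ‖x - z‖ ^ 2 := by
      rw [norm_sub_sq_real, norm_sub_sq_real, norm_smul, norm_smul, inner_smul_left,
        inner_smul_right, hxn, hzn, mul_pow, mul_pow, Real.norm_eq_abs, Real.norm_eq_abs,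
        sq_abs, sq_abs]
      simp only [conj_trivial]
      ring
    have h3 : ‖x - z‖ ≤ 4 * ‖a • x - c • z‖ := by
      refine abs_le_of_sq_le_sq' ?_ (by positivity) |>.2
      nlinarith [sq_nonneg (r * (a - c)), mul_le_mul_of_nonneg_right hac (sq_nonneg ‖x - z‖)]
    have h4 : r * |a - c| ≤ ‖a • x - c • z‖ := by
      refine abs_le_of_sq_le_sq' ?_ (by positivity) |>.2
      rw [mul_pow, sq_abs, e2]
      have : 0 ≤ a * c * ‖x - z‖ ^ 2 := by positivity
      linarith
    have h5 : |a - b| ≤ |a - c| + |f x - f z| := by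
      have h := abs_sub_le a c b
      have : |c - b| = |f x - f z| := by
        rw [abs_sub_comm]; congr 1; rw [hb, hc]; ring
      linarith
    calc |a - b| * r ≤ (|a - c| + δ * ‖x - z‖) * r := by
          apply mul_le_mul_of_nonneg_right _ hr.le
          linarith
      _ = r * |a - c| + δ * r * ‖x - z‖ := by ring
      _ ≤ ‖a • x - c • z‖ + δ * r * (4 * ‖a • x - c • z‖) := by gcongr
      _ = ‖a • x - c • z‖ * (1 + 4 * r * δ) := by ring
      _ ≤ ‖a • x - c • z‖ * (1 + η) := by gcongr
  · rw [← dist_eq_norm]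
    exact infDist_le_dist_of_mem hmem
end
end

section
/- Let N ≥ 1, let r₀ > 0, c₀ > 0, and let F ⊂ ℝ^N be a measurable set with |F| = m ∈ (0, ∞) such that |B_{r₀}(x) ∩ F| ≥ c₀·r₀^N for every x ∈ F. Then there exists a finite set C ⊂ F of cardinality at most m/(c₀·r₀^N) such that F ⊂ ∪_{x∈C} closure(B_{5r₀}(x)); consequently, every connected component of F has diameter at most 10·m/(c₀·r₀^{N−1}). -/
open MeasureTheory Metric Set

/-- Any finite subset of `F` with pairwise `2r₀`-separated points has bounded cardinality. -/
lemma card_bound_of_density {N : ℕ} {r₀ a m : ℝ} (ha : 0 < a) (hm : 0 < m)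
    (F : Set (EuclideanSpace ℝ (Fin N))) (hF : MeasurableSet F)
    (hvol : volume F = ENNReal.ofReal m)
    (hdens : ∀ x ∈ F, ENNReal.ofReal a ≤ volume (ball x r₀ ∩ F))
    (C : Finset (EuclideanSpace ℝ (Fin N))) (hC : (C : Set _) ⊆ F)
    (hsep : ∀ x ∈ C, ∀ y ∈ C, x ≠ y → r₀ + r₀ ≤ dist x y) :
    (C.card : ℝ) ≤ m / a := by
  have h1 : volume (⋃ x ∈ C, ball x r₀ ∩ F) = ∑ x ∈ C, volume (ball x r₀ ∩ F) := by
    apply measure_biUnion_finset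
    · intro x hx y hy hxy
      exact (ball_disjoint_ball (hsep x hx y hy hxy)).mono inter_subset_left inter_subset_left
    · intro x _
      exact measurableSet_ball.inter hF
  have h2 : volume (⋃ x ∈ C, ball x r₀ ∩ F) ≤ volume F :=
    measure_mono (iUnion₂_subset fun x _ => inter_subset_right)
  have h3 : ∑ x ∈ C, ENNReal.ofReal a ≤ ∑ x ∈ C, volume (ball x r₀ ∩ F) :=
    Finset.sum_le_sum fun x hx => hdens x (hC hx)
  rw [h1, hvol] at h2
  have h4 := h3.trans h2
  rw [← ENNReal.ofReal_sum_of_nonneg (fun _ _ => ha.le), ENNReal.ofReal_le_ofReal_iff hm.le] at h4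
  rw [le_div_iff₀ ha]
  simpa using h4

/-- A connected set covered by `k` closed balls of radius `R` has diameter at most `2Rk`. -/
lemma diam_le_of_preconnected_cover {X : Type*} [PseudoMetricSpace X] {R : ℝ} (hR : 0 ≤ R)
    (C : Finset X) (K : Set X) (hK : IsPreconnected K)
    (hcov : K ⊆ ⋃ x ∈ C, closedBall x R) :
    Metric.diam K ≤ C.card * (2 * R) := by
  apply Metric.diam_le_of_forall_dist_le (by positivity)
  intro y hy z hz
  have him : IsPreconnected ((fun w => dist y w) '' K) :=
    hK.image _ (by fun_prop)
  have hsub : Icc 0 (dist y z) ⊆ (fun w => dist y w) '' K :=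
    him.Icc_subset ⟨y, hy, dist_self y⟩ ⟨z, hz, rfl⟩
  have hsub2 : Icc 0 (dist y z) ⊆ ⋃ x ∈ C, Icc (dist y x - R) (dist y x + R) := by
    intro t ht
    obtain ⟨w, hw, rfl⟩ := hsub ht
    obtain ⟨x, hx, hwx⟩ := mem_iUnion₂.1 (hcov hw)
    rw [mem_closedBall] at hwx
    refine mem_iUnion₂.2 ⟨x, hx, ?_, ?_⟩
    · have := dist_triangle y w x
      simp only
      linarith
    · have := dist_triangle y x w
      rw [dist_comm x w] at this
      simp only
      linarith
  have hv := (measure_mono (μ := volume) hsub2).trans (measure_biUnion_finset_le C _)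
  simp only [Real.volume_Icc] at hv
  rw [← ENNReal.ofReal_sum_of_nonneg (fun _ _ => by linarith),
    ENNReal.ofReal_le_ofReal_iff (Finset.sum_nonneg fun _ _ => by linarith)] at hv
  calc dist y z = dist y z - 0 := by ring
    _ ≤ _ := hv
    _ = ∑ x ∈ C, 2 * R := Finset.sum_congr rfl fun _ _ => by ring
    _ = _ := by simp

/-- The Vitali covering argument of Proposition 2.3 vi): a set of measure `m` whose points
all carry a uniform lower volume density at scale `r₀` is covered by at most
`m/(c₀ r₀^N)` closed balls of radius `5r₀`, and hence its connected components have
diameter at most `10 m/(c₀ r₀^{N-1})`. -/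
theorem covering_and_diameter_bound_of_density
    (N : ℕ) (hN : 1 ≤ N) (r₀ c₀ m : ℝ) (hr₀ : 0 < r₀) (hc₀ : 0 < c₀) (hm : 0 < m)
    (F : Set (EuclideanSpace ℝ (Fin N))) (hF : MeasurableSet F)
    (hvol : volume F = ENNReal.ofReal m)
    (hdens : ∀ x ∈ F, ENNReal.ofReal (c₀ * r₀ ^ N) ≤ volume (ball x r₀ ∩ F)) :
    ∃ C : Set (EuclideanSpace ℝ (Fin N)), C ⊆ F ∧ C.Finite ∧
      (C.ncard : ℝ) ≤ m / (c₀ * r₀ ^ N) ∧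
      F ⊆ ⋃ x ∈ C, closure (ball x (5 * r₀)) ∧
      ∀ x ∈ F, Metric.diam (connectedComponentIn F x) ≤ 10 * m / (c₀ * r₀ ^ (N - 1)) := by
  classical
  have ha : 0 < c₀ * r₀ ^ N := by positivity
  let P : ℕ → Prop := fun k => ∃ C : Finset (EuclideanSpace ℝ (Fin N)), (C : Set _) ⊆ F ∧
    (∀ x ∈ C, ∀ y ∈ C, x ≠ y → r₀ + r₀ ≤ dist x y) ∧ C.card = k
  have hP0 : P 0 := ⟨∅, by simp, by simp, by simp⟩
  have hPb : ∀ k, P k → k ≤ ⌊m / (c₀ * r₀ ^ N)⌋₊ := by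
    rintro k ⟨C, hC, hs, rfl⟩
    exact Nat.le_floor (card_bound_of_density ha hm F hF hvol hdens C hC hs)
  obtain ⟨C, hC, hs, hk⟩ : P (Nat.findGreatest P ⌊m / (c₀ * r₀ ^ N)⌋₊) :=
    Nat.findGreatest_spec (Nat.zero_le _) hP0
  have hcard := card_bound_of_density ha hm F hF hvol hdens C hC hs
  have hcov : F ⊆ ⋃ x ∈ C, closedBall x (5 * r₀) := by
    intro x hx
    by_contra hcon
    simp only [mem_iUnion, mem_closedBall, not_exists, not_le] at hcon
    have hxC : x ∉ C := fun h => by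
      have := hcon x h
      rw [dist_self] at this
      linarith
    have hP : P (C.card + 1) := by
      refine ⟨insert x C, ?_, ?_, Finset.card_insert_of_notMem hxC⟩
      · rw [Finset.coe_insert]
        exact insert_subset hx hC
      · intro u hu v hv huv
        rcases Finset.mem_insert.1 hu with rfl | huC <;> rcases Finset.mem_insert.1 hv with rfl | hvC
        · exact absurd rfl huv
        · have := hcon v hvC
          linarith
        · have := hcon u huC
          rw [dist_comm] at this
          linarith
        · exact hs u huC v hvC huv
    have := Nat.le_findGreatest (hPb _ hP) hP
    omega
  refine ⟨C, hC, C.finite_toSet, by rwa [Set.ncard_coe_finset], ?_, ?_⟩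
  · intro x hx
    obtain ⟨y, hy, hxy⟩ := mem_iUnion₂.1 (hcov hx)
    refine mem_iUnion₂.2 ⟨y, hy, ?_⟩
    rwa [closure_ball y (by positivity)]
  · intro x _
    refine (diam_le_of_preconnected_cover (R := 5 * r₀) (by positivity) C _
      isPreconnected_connectedComponentIn
      ((connectedComponentIn_subset F x).trans hcov)).trans ?_
    calc (C.card : ℝ) * (2 * (5 * r₀)) ≤ m / (c₀ * r₀ ^ N) * (2 * (5 * r₀)) := by gcongr
      _ = 10 * m / (c₀ * r₀ ^ (N - 1)) := by
        obtain ⟨n, rfl⟩ : ∃ n, N = n + 1 := ⟨N - 1, by omega⟩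
        rw [Nat.add_sub_cancel, pow_succ]
        field_simp
        norm_num
end

section
/- Let N ≥ 2, R > 0 and c₀ > 0. There exist ρ > 0 and s₀ > 0 with the following property: whenever x₁, x₂ ∈ ℝ^N satisfy 2R < |x₁ − x₂| ≤ 2R + s₀, setting E := B_R(x₁) ∪ B_R(x₂) (the union of the two disjoint open balls), there exists a point x ∈ ∂E such that |B_ρ(x) ∖ E| < c₀·ρ^N. -/
open MeasureTheory Metric Set

lemma slab_volume_le (N : ℕ) (hN : 0 < N) (x u : EuclideanSpace ℝ (Fin N)) (hu : ‖u‖ = 1)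
    (ρ a : ℝ) (hρ : 0 < ρ) (ha : 0 < a) (S : Set (EuclideanSpace ℝ (Fin N)))
    (hS : ∀ y ∈ S, ‖y - x‖ ≤ ρ ∧ |inner ℝ u (y - x)| ≤ a) :
    volume S ≤ ENNReal.ofReal ((2 * a) * (2 * ρ) ^ (N - 1)) := by
  classical
  let i0 : Fin N := ⟨0, hN⟩
  obtain ⟨b, hb⟩ := Orthonormal.exists_orthonormalBasis_extension_of_card_eq
    (𝕜 := ℝ) (E := EuclideanSpace ℝ (Fin N)) (ι := Fin N) (by simp)
    (v := fun _ => u) (s := {i0}) (by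
      rw [orthonormal_iff_ite]
      rintro ⟨i, hi⟩ ⟨j, hj⟩
      have h1 : i = i0 := hi
      have h2 : j = i0 := hj
      subst h1 h2
      simp [hu])
  have hb0 : b i0 = u := hb i0 rfl
  let r : Fin N → ℝ := fun i => if i = i0 then a else ρ
  let T : Set (Fin N → ℝ) := Set.pi univ (fun i => Icc (-r i) (r i))
  have hT : MeasurableSet T := MeasurableSet.univ_pi (fun i => measurableSet_Icc)
  have hmp : MeasurePreserving
      (fun y : EuclideanSpace ℝ (Fin N) => WithLp.ofLp (b.repr (y - x))) volume volume :=
    ((PiLp.volume_preserving_ofLp (Fin N)).comp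
      b.measurePreserving_repr).comp (measurePreserving_sub_right volume x)
  have hsub : S ⊆ (fun y : EuclideanSpace ℝ (Fin N) => WithLp.ofLp (b.repr (y - x))) ⁻¹' T := by
    intro y hy
    obtain ⟨h1, h2⟩ := hS y hy
    simp only [mem_preimage, T, Set.mem_pi, mem_univ, forall_true_left]
    intro i
    rw [mem_Icc, ← abs_le, b.repr_apply_apply]
    by_cases hi : i = i0
    · simp only [r, hi, if_true, hb0]; exact h2
    · simp only [r, hi, if_false]
      refine (abs_real_inner_le_norm _ _).trans ?_
      simpa using h1
  calc volume S ≤ _ := measure_mono hsub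
    _ = volume T := hmp.measure_preimage hT.nullMeasurableSet
    _ = ∏ i, ENNReal.ofReal (2 * r i) := by
      simp only [T]
      rw [volume_pi_pi]
      refine Finset.prod_congr rfl fun i _ => ?_
      rw [Real.volume_Icc]; congr 1; ring
    _ = ENNReal.ofReal (∏ i, (2 * r i)) := by
      rw [ENNReal.ofReal_prod_of_nonneg]
      intro i _
      simp only [r]; split_ifs <;> positivity
    _ = _ := by
      congr 1
      rw [← Finset.mul_prod_erase Finset.univ _ (Finset.mem_univ i0)]
      have : ∏ i ∈ Finset.univ.erase i0, (2 * r i) = ∏ i ∈ Finset.univ.erase i0, (2 * ρ) := by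
        refine Finset.prod_congr rfl fun i hi => ?_
        simp [r, Finset.ne_of_mem_erase hi]
      rw [this]
      simp [r]
    _ ≤ _ := le_rfl

/-- The geometric claim in the proof of Proposition 3.1: two disjoint balls of equal
radius `R` at mutual distance at most `s₀` violate the uniform exterior density estimate
`|B_ρ(x) ∖ E| ≥ c₀ ρ^N` at some boundary point. -/
theorem close_balls_violate_exterior_density
    (N : ℕ) (hN : 2 ≤ N) (R c₀ : ℝ) (hR : 0 < R) (hc₀ : 0 < c₀) :
    ∃ ρ > (0 : ℝ), ∃ s₀ > (0 : ℝ),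
      ∀ x₁ x₂ : EuclideanSpace ℝ (Fin N),
        2 * R < dist x₁ x₂ → dist x₁ x₂ ≤ 2 * R + s₀ →
        ∃ x ∈ frontier (ball x₁ R ∪ ball x₂ R),
          volume (ball x ρ \ (ball x₁ R ∪ ball x₂ R)) < ENNReal.ofReal (c₀ * ρ ^ N) := by
  obtain ⟨ρ, hρ, hρ2⟩ : ∃ ρ > (0 : ℝ), 2 ^ N * ρ < c₀ * R :=
    ⟨c₀ * R / 2 ^ (N + 1), by positivity, by
      have : (2:ℝ) ^ N * (c₀ * R / 2 ^ (N + 1)) = c₀ * R / 2 := by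
        rw [pow_succ]; field_simp
      rw [this]; have := mul_pos hc₀ hR; linarith⟩
  refine ⟨ρ, hρ, ρ ^ 2 / (2 * R), by positivity, fun x₁ x₂ h1 h2 => ?_⟩
  set d := dist x₁ x₂ with hd
  have hd0 : 0 < d := by linarith
  have hdn : ‖x₂ - x₁‖ = d := by rw [hd, dist_comm, dist_eq_norm]
  obtain ⟨u, hu, hx2⟩ : ∃ u : EuclideanSpace ℝ (Fin N), ‖u‖ = 1 ∧ x₂ = x₁ + d • u := by
    refine ⟨d⁻¹ • (x₂ - x₁), ?_, ?_⟩
    · rw [norm_smul, hdn, norm_inv, Real.norm_of_nonneg hd0.le, inv_mul_cancel₀ hd0.ne']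
    · rw [smul_smul, mul_inv_cancel₀ hd0.ne', one_smul]; abel
  have hx1n : dist (x₁ + R • u) x₁ = R := by
    rw [dist_eq_norm, add_sub_cancel_left, norm_smul, hu, mul_one, Real.norm_of_nonneg hR.le]
  refine ⟨x₁ + R • u, ?_, ?_⟩
  · rw [(isOpen_ball.union isOpen_ball).frontier_eq]
    refine ⟨closure_mono subset_union_left ?_, ?_⟩
    · rw [closure_ball _ hR.ne', mem_closedBall, hx1n]
    · rintro (h | h)
      · rw [mem_ball, hx1n] at h; exact lt_irrefl _ h
      · rw [mem_ball] at h
        have := dist_triangle x₁ (x₁ + R • u) x₂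
        rw [dist_comm x₁ (x₁ + R • u), hx1n] at this
        linarith
  · refine (slab_volume_le N (by omega) (x₁ + R • u) u hu ρ (ρ ^ 2 / R) hρ (by positivity) _
      ?_).trans_lt ?_
    · rintro y ⟨hy, hyE⟩
      rw [mem_ball, dist_eq_norm] at hy
      simp only [mem_union, mem_ball, not_or, not_lt, dist_eq_norm] at hyE
      obtain ⟨hy1, hy2⟩ := hyE
      obtain ⟨z, hz⟩ : ∃ z, z = y - (x₁ + R • u) := ⟨_, rfl⟩
      have e1 : y - x₁ = z + R • u := by rw [hz]; abel
      have e2 : y - x₂ = z - (d - R) • u := by rw [hz, hx2, sub_smul]; abel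
      rw [← hz] at hy ⊢
      rw [e1] at hy1
      rw [e2] at hy2
      refine ⟨hy.le, ?_⟩
      have q1 := pow_le_pow_left₀ hR.le hy1 2
      have q2 := pow_le_pow_left₀ hR.le hy2 2
      have q3 := pow_le_pow_left₀ (norm_nonneg _) hy.le 2
      rw [norm_add_sq_real, inner_smul_right, norm_smul, hu, mul_one, Real.norm_eq_abs,
        sq_abs, real_inner_comm] at q1
      rw [norm_sub_sq_real, inner_smul_right, norm_smul, hu, mul_one, Real.norm_eq_abs,
        sq_abs, real_inner_comm] at q2
      generalize inner ℝ u z = t at *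
      have hs : (d - 2 * R) * (2 * R) ≤ ρ ^ 2 := by
        rw [← le_div_iff₀ (by positivity)]; linarith
      obtain ⟨s, hsd⟩ : ∃ s, s = d - 2 * R := ⟨_, rfl⟩
      have hds : d = 2 * R + s := by linarith
      rw [hds] at q2 hs
      have hs0 : 0 < s := by linarith
      rw [abs_le, neg_le, le_div_iff₀ hR, le_div_iff₀ hR]
      constructor
      · nlinarith
      · by_contra! hcon
        have ht : 0 < t := by
          by_contra! h
          nlinarith [sq_nonneg ρ]
        -- 2 (R+s) t ≤ ρ² + 2 R s + s²
        have k1 : 2 * (R + s) * t ≤ ρ ^ 2 + 2 * R * s + s ^ 2 := by nlinarith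
        have k2 : s < 2 * t := by nlinarith
        nlinarith [mul_pos hs0 (sub_pos.2 k2)]
    · rw [ENNReal.ofReal_lt_ofReal_iff (by positivity)]
      obtain ⟨n, rfl⟩ : ∃ n, N = n + 1 := ⟨N - 1, by omega⟩
      have : 2 * (ρ ^ 2 / R) * (2 * ρ) ^ (n + 1 - 1) = (2 ^ (n + 1) * ρ) / R * ρ ^ (n + 1) := by
        rw [Nat.add_sub_cancel, mul_pow]; ring
      rw [this]
      have : (2 ^ (n + 1) * ρ) / R < c₀ := by rwa [div_lt_iff₀ hR]
      gcongr
end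

section
/- Let N ≥ 1 and let G, G_n ⊂ ℝ^N (n ∈ ℕ) be measurable sets, each with nonempty topological boundary, such that the indicator functions χ_{G_n} converge to χ_G in L¹_loc(ℝ^N). Assume there exist c₀ ∈ (0,1) and r₀ > 0 such that for every n, every x ∈ ∂G_n and every ρ ∈ (0, r₀], one has |B_ρ(x) ∩ G_n| ≥ c₀·ρ^N and |B_ρ(x) ∖ G_n| ≥ c₀·ρ^N, and the same two-sided density estimates hold for G. Then dist(·, ∂G_n) → dist(·, ∂G) locally uniformly on ℝ^N. -/
open MeasureTheory Metric Set Filter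

/-- A boundary point of `A` with density estimates must be near the boundary of `B`
if the symmetric difference is small. -/
theorem exists_frontier_near {N : ℕ} (A B K : Set (EuclideanSpace ℝ (Fin N)))
    (x : EuclideanSpace ℝ (Fin N)) (ρ : ℝ) (m : ENNReal) (hρ : 0 < ρ)
    (hK : ball x ρ ⊆ K)
    (h1 : m ≤ volume (ball x ρ ∩ A)) (h2 : m ≤ volume (ball x ρ \ A))
    (hm : volume (symmDiff A B ∩ K) < m) :
    ∃ z ∈ frontier B, dist z x < ρ := by
  by_contra! hcon
  have hdis : ∀ z ∈ ball x ρ, z ∉ frontier B := fun z hz hzB =>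
    absurd (mem_ball.1 hz) (not_lt.2 (hcon z hzB))
  have hpre : IsPreconnected (ball x ρ) := (convex_ball x ρ).isPreconnected
  have hor : ball x ρ ⊆ B ∨ ball x ρ ⊆ Bᶜ := by
    by_contra! h
    obtain ⟨h3, h4⟩ := h
    obtain ⟨p, hp, hpB⟩ := not_subset.1 h3
    obtain ⟨q, hq, hqB⟩ := not_subset.1 h4
    have hqB : q ∈ B := by simpa using hqB
    have key : ∀ z ∈ ball x ρ, z ∈ closure B → z ∈ interior B := fun z hz hzc => by
      by_contra hzi
      exact hdis z hz ⟨hzc, hzi⟩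
    obtain ⟨z, -, hzi, hzc⟩ := hpre (interior B) (closure B)ᶜ isOpen_interior
      isClosed_closure.isOpen_compl
      (fun z hz => (em (z ∈ closure B)).imp (key z hz) id)
      ⟨q, hq, key q hq (subset_closure hqB)⟩
      ⟨p, hp, fun hpc => hpB (interior_subset (key p hp hpc))⟩
    exact hzc (subset_closure (interior_subset hzi))
  rcases hor with h | h
  · refine absurd (h2.trans (measure_mono ?_)) (not_le.2 hm)
    rintro z ⟨hz, hzA⟩
    exact ⟨Or.inr ⟨h hz, hzA⟩, hK hz⟩
  · refine absurd (h1.trans (measure_mono ?_)) (not_le.2 hm)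
    rintro z ⟨hz, hzA⟩
    exact ⟨Or.inl ⟨hzA, h hz⟩, hK hz⟩

/-- The core of Lemma 3.4: `L¹_loc` convergence of sets satisfying uniform two-sided
density estimates upgrades to locally uniform convergence of the distance functions to
their boundaries. -/
theorem dist_to_boundary_locally_uniform_convergence
    (N : ℕ) (hN : 1 ≤ N)
    (G : Set (EuclideanSpace ℝ (Fin N))) (Gn : ℕ → Set (EuclideanSpace ℝ (Fin N)))
    (hGmeas : MeasurableSet G) (hGnmeas : ∀ n, MeasurableSet (Gn n))
    (hGb : (frontier G).Nonempty) (hGnb : ∀ n, (frontier (Gn n)).Nonempty)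
    (c₀ r₀ : ℝ) (hc₀ : 0 < c₀) (hc₀1 : c₀ < 1) (hr₀ : 0 < r₀)
    (hconv : ∀ K : Set (EuclideanSpace ℝ (Fin N)), IsCompact K →
      Tendsto (fun n => volume (symmDiff (Gn n) G ∩ K)) atTop (nhds 0))
    (hdens : ∀ n, ∀ x ∈ frontier (Gn n), ∀ ρ ∈ Set.Ioc (0 : ℝ) r₀,
      ENNReal.ofReal (c₀ * ρ ^ N) ≤ volume (ball x ρ ∩ Gn n) ∧
      ENNReal.ofReal (c₀ * ρ ^ N) ≤ volume (ball x ρ \ Gn n))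
    (hdensG : ∀ x ∈ frontier G, ∀ ρ ∈ Set.Ioc (0 : ℝ) r₀,
      ENNReal.ofReal (c₀ * ρ ^ N) ≤ volume (ball x ρ ∩ G) ∧
      ENNReal.ofReal (c₀ * ρ ^ N) ≤ volume (ball x ρ \ G)) :
    TendstoLocallyUniformly (fun n x => infDist x (frontier (Gn n)))
      (fun x => infDist x (frontier G)) atTop := by
  rw [Metric.tendstoLocallyUniformly_iff]
  intro ε hε x
  refine ⟨ball x 1, ball_mem_nhds x one_pos, ?_⟩
  obtain ⟨z0, hz0⟩ := hGb
  set ρ := min (ε / 2) r₀ with hρdef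
  have hρ : 0 < ρ := lt_min (by linarith) hr₀
  have hρε : ρ ≤ ε / 2 := min_le_left _ _
  have hρr : ρ ∈ Set.Ioc (0 : ℝ) r₀ := ⟨hρ, min_le_right _ _⟩
  set K := closedBall x (2 + dist x z0 + 2 * ε) with hKdef
  have hm : 0 < ENNReal.ofReal (c₀ * ρ ^ N) := by
    rw [ENNReal.ofReal_pos]; positivity
  filter_upwards [(hconv K (isCompact_closedBall _ _)).eventually_lt_const hm] with n hn y hy
  have hyx : dist y x < 1 := hy
  have hdy : infDist y (frontier G) ≤ 1 + dist x z0 := by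
    have h1 := infDist_le_dist_of_mem (x := y) hz0
    have h2 := dist_triangle y x z0
    linarith
  have hsub : ∀ w, dist y w ≤ 1 + dist x z0 + ε / 2 → ball w ρ ⊆ K := by
    intro w hw v hv
    have h1 : dist v w < ρ := hv
    have h2 := dist_triangle v w x
    have h3 := dist_triangle w y x
    rw [dist_comm w y] at h3
    simp only [hKdef, mem_closedBall]
    linarith
  obtain ⟨w, hw, hwd⟩ := (isClosed_frontier (s := G)).exists_infDist_eq_dist ⟨z0, hz0⟩ y
  obtain ⟨v, hv, hvd⟩ := exists_frontier_near G (Gn n) K w ρ _ hρ (hsub w (by linarith))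
    (hdensG w hw ρ hρr).1 (hdensG w hw ρ hρr).2 (by rwa [symmDiff_comm])
  have hle1 : infDist y (frontier (Gn n)) ≤ infDist y (frontier G) + ρ := by
    have h1 := infDist_le_dist_of_mem (x := y) hv
    have h2 := dist_triangle y w v
    rw [dist_comm w v] at h2
    linarith
  obtain ⟨w', hw', hwd'⟩ :=
    (isClosed_frontier (s := Gn n)).exists_infDist_eq_dist (hGnb n) y
  obtain ⟨v', hv', hvd'⟩ := exists_frontier_near (Gn n) G K w' ρ _ hρ (hsub w' (by linarith))
    (hdens n w' hw' ρ hρr).1 (hdens n w' hw' ρ hρr).2 hn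
  have hle2 : infDist y (frontier G) ≤ infDist y (frontier (Gn n)) + ρ := by
    have h1 := infDist_le_dist_of_mem (x := y) hv'
    have h2 := dist_triangle y w' v'
    rw [dist_comm w' v'] at h2
    linarith
  rw [Real.dist_eq, abs_lt]
  constructor <;> linarith
end

section
/- Let N ≥ 2 and μ > 0. There exists a constant C = C(N, μ) > 0 with the following property: for every pair of bounded continuous functions f₁, f₂ : ∂B^{(μ)} → ℝ with ‖f_i‖_∞ ≤ 1/2 and |E_{f_i,μ}| = μ for i = 1,2, one has |bar(E_{f₁,μ}) − bar(E_{f₂,μ})| ≤ C·( ∫_{∂B^{(μ)}} |f₁ − f₂|² dH^{N−1} )^{1/2}. -/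
open MeasureTheory Metric Set

noncomputable section

lemma half_sphere_fin (n : ℕ) (v : EuclideanSpace ℝ (Fin (n+1))) (hv : ‖v‖ = 1) :
    μH[(n:ℝ)] {x : EuclideanSpace ℝ (Fin (n+1)) | ‖x‖ = 1 ∧ inner ℝ v x ≤ 0} < ⊤ := by
  set V := (Submodule.span ℝ {v})ᗮ with hV
  set F : V → EuclideanSpace ℝ (Fin (n+1)) := fun w => stereoInvFunAux v (w : EuclideanSpace ℝ (Fin (n+1))) with hF
  have hFd : ContDiff ℝ 1 F := contDiff_stereoInvFunAux.comp V.subtypeL.contDiff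
  have hvn : v ≠ 0 := by intro h; simp [h] at hv
  have hdim : Module.finrank ℝ V = n := by
    have : Fact (Module.finrank ℝ (EuclideanSpace ℝ (Fin (n+1))) = n+1) := ⟨by simp⟩
    exact Submodule.finrank_orthogonal_span_singleton hvn
  obtain ⟨C, hC⟩ := (isCompact_closedBall (0:V) 2).exists_bound_of_continuousOn
    (hFd.continuous_fderiv one_ne_zero).continuousOn
  have hL : LipschitzOnWith C.toNNReal F (closedBall (0:V) 2) := by
    apply Convex.lipschitzOnWith_of_nnnorm_fderiv_le (𝕜 := ℝ)
      (fun x _ => hFd.differentiable one_ne_zero x) _ (convex_closedBall _ _)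
    intro x hx
    rw [← NNReal.coe_le_coe]
    exact (hC x hx).trans (Real.le_coe_toNNReal C)
  have hsub : {x : EuclideanSpace ℝ (Fin (n+1)) | ‖x‖ = 1 ∧ inner ℝ v x ≤ 0} ⊆ F '' closedBall (0:V) 2 := by
    rintro x ⟨hx, hi⟩
    have hxv : x ≠ v := by
      rintro rfl
      rw [real_inner_self_eq_norm_sq, hx] at hi
      norm_num at hi
    refine ⟨stereoToFun v x, ?_, ?_⟩
    · rw [mem_closedBall_zero_iff, stereoToFun_apply, norm_smul]
      have h1 : ‖V.orthogonalProjectionOnto x‖ ≤ 1 := by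
        have := V.norm_orthogonalProjectionOnto_apply_le x
        rwa [hx] at this
      have h2 : ‖2 / ((1 : ℝ) - innerSL ℝ v x)‖ ≤ 2 := by
        simp only [innerSL_apply_apply]
        rw [Real.norm_eq_abs, abs_of_nonneg (div_nonneg (by norm_num) (by linarith)), div_le_iff₀ (by linarith)]
        linarith
      calc _ ≤ (2:ℝ) * 1 := mul_le_mul h2 h1 (norm_nonneg _) (by norm_num)
        _ = 2 := by norm_num
    · have := stereo_left_inv hv (x := ⟨x, by simpa using hx⟩) hxv
      exact congrArg Subtype.val this
  refine (measure_mono hsub).trans_lt ((hL.hausdorffMeasure_image_le (Nat.cast_nonneg n)).trans_lt ?_)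
  refine ENNReal.mul_lt_top (ENNReal.rpow_lt_top_of_nonneg (Nat.cast_nonneg n) ENNReal.coe_ne_top) ?_
  have := isAddHaarMeasure_hausdorffMeasure (E := V)
  rw [hdim] at this
  exact (isCompact_closedBall (0:V) 2).measure_lt_top

lemma sphere_fin (n : ℕ) (r : ℝ) : μH[(n:ℝ)] (sphere (0 : EuclideanSpace ℝ (Fin (n+1))) r) < ⊤ := by
  rcases lt_or_ge r 0 with h | h
  · simp [sphere_eq_empty_of_neg h]
  have h1 : μH[(n:ℝ)] (sphere (0 : EuclideanSpace ℝ (Fin (n+1))) 1) < ⊤ := by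
    obtain ⟨v, hv⟩ : ∃ v : EuclideanSpace ℝ (Fin (n+1)), ‖v‖ = 1 := exists_norm_eq _ zero_le_one
    have hs : sphere (0 : EuclideanSpace ℝ (Fin (n+1))) 1 ⊆ {x : EuclideanSpace ℝ (Fin (n+1)) | ‖x‖ = 1 ∧ inner ℝ v x ≤ 0} ∪
        {x : EuclideanSpace ℝ (Fin (n+1)) | ‖x‖ = 1 ∧ inner ℝ (-v) x ≤ 0} := by
      intro x hx
      rw [mem_sphere_zero_iff_norm] at hx
      rcases le_total (inner ℝ v x) 0 with h | h
      · exact Or.inl ⟨hx, h⟩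
      · exact Or.inr ⟨hx, by simpa using h⟩
    exact (measure_mono hs).trans_lt (measure_union_lt_top (half_sphere_fin n v hv)
      (half_sphere_fin n (-v) (by simpa using hv)))
  have hsub : sphere (0 : EuclideanSpace ℝ (Fin (n+1))) r ⊆ (fun x => r • x) '' sphere (0 : EuclideanSpace ℝ (Fin (n+1))) 1 := by
    intro x hx
    rw [mem_sphere_zero_iff_norm] at hx
    rcases h.eq_or_lt with h | h
    · subst h
      obtain ⟨v, hv⟩ : ∃ v : EuclideanSpace ℝ (Fin (n+1)), ‖v‖ = 1 := exists_norm_eq _ zero_le_one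
      refine ⟨v, by simpa using hv, ?_⟩
      simpa using (norm_eq_zero.1 hx).symm
    · refine ⟨r⁻¹ • x, ?_, ?_⟩
      · simp [norm_smul, hx, abs_of_pos h, h.ne']
      · simp [smul_smul, h.ne']
  refine (measure_mono hsub).trans_lt (((lipschitzWith_smul r).hausdorffMeasure_image_le (Nat.cast_nonneg n) _).trans_lt ?_)
  exact ENNReal.mul_lt_top (ENNReal.rpow_lt_top_of_nonneg (Nat.cast_nonneg n) ENNReal.coe_ne_top) h1

open scoped Pointwise ENNReal

lemma cone_ball (n : ℕ) : ∃ C : ℝ, 0 < C ∧ ∀ (x : sphere (0 : EuclideanSpace ℝ (Fin (n+1))) 1) (ε : ℝ), 0 < ε → ε ≤ 1 →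
    (volume : Measure (EuclideanSpace ℝ (Fin (n+1)))).toSphere (closedBall x ε) ≤ ENNReal.ofReal (C * ε ^ n) := by
  refine ⟨(n+1) * (2 * 2^(n+1) * (ballVolume (n+1) + 1)), ?_, ?_⟩
  · have : 0 ≤ ballVolume (n+1) := ENNReal.toReal_nonneg
    positivity
  intro x ε h0 h1
  have hx : ‖(x : EuclideanSpace ℝ (Fin (n+1)))‖ = 1 := by simp
  rw [Measure.toSphere_apply' _ measurableSet_closedBall]
  set m := ⌈ε⁻¹⌉₊ with hm
  have hm1 : ε⁻¹ ≤ m := Nat.le_ceil _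
  have hεi : 1 ≤ ε⁻¹ := (one_le_inv₀ h0).2 h1
  have hm0 : (0:ℝ) < m := by linarith
  have hm2 : (m:ℝ) ≤ 2 * ε⁻¹ := by
    have := Nat.ceil_lt_add_one (a := ε⁻¹) (by positivity)
    linarith
  have hme : 1 / (m:ℝ) ≤ ε := by
    rw [one_div]; exact inv_le_of_inv_le₀ h0 hm1
  have hsub : Ioo (0 : ℝ) 1 • ((fun y : sphere (0 : EuclideanSpace ℝ (Fin (n+1))) 1 => (y : EuclideanSpace ℝ (Fin (n+1)))) '' closedBall x ε) ⊆
      ⋃ k ∈ Finset.range m, closedBall (((k:ℝ)/m) • (x : EuclideanSpace ℝ (Fin (n+1)))) (2*ε) := by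
    rintro z ⟨t, ht, y, ⟨y, hy, rfl⟩, rfl⟩
    have hk : ⌊t * m⌋₊ < m := by
      rw [Nat.floor_lt (by have := ht.1; positivity)]
      nlinarith [ht.2]
    simp only [mem_iUnion]
    refine ⟨⌊t * m⌋₊, Finset.mem_range.2 hk, ?_⟩
    rw [mem_closedBall, dist_eq_norm]
    have hyx : ‖(y : EuclideanSpace ℝ (Fin (n+1))) - x‖ ≤ ε := by rw [← dist_eq_norm]; exact hy
    have hfl : |t - (⌊t * m⌋₊ : ℝ) / m| ≤ 1 / m := by
      have a1 := Nat.floor_le (a := t * m) (by have := ht.1; positivity)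
      have a2 := Nat.lt_floor_add_one (t * m)
      rw [show t - (⌊t * m⌋₊ : ℝ) / m = (t * m - ⌊t * m⌋₊) / m by field_simp, abs_div, abs_of_pos hm0]
      gcongr
      rw [abs_le]; constructor <;> linarith
    have : t • (y : EuclideanSpace ℝ (Fin (n+1))) - ((⌊t * m⌋₊ : ℝ) / m) • (x : EuclideanSpace ℝ (Fin (n+1))) =
      t • ((y : EuclideanSpace ℝ (Fin (n+1))) - x) + (t - (⌊t * m⌋₊ : ℝ) / m) • (x : EuclideanSpace ℝ (Fin (n+1))) := by
      module
    change ‖t • (y : EuclideanSpace ℝ (Fin (n+1))) - ((⌊t * m⌋₊ : ℝ) / m) • (x : EuclideanSpace ℝ (Fin (n+1)))‖ ≤ _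
    rw [this]
    refine (norm_add_le _ _).trans ?_
    rw [norm_smul, norm_smul, hx, Real.norm_eq_abs, Real.norm_eq_abs, abs_of_pos ht.1]
    have : t * ‖(y : EuclideanSpace ℝ (Fin (n+1))) - x‖ ≤ 1 * ε := mul_le_mul ht.2.le hyx (norm_nonneg _) zero_le_one
    linarith
  have hvol : ∀ z : EuclideanSpace ℝ (Fin (n+1)), volume (closedBall z (2*ε)) = ENNReal.ofReal ((2*ε)^(n+1) * ballVolume (n+1)) := by
    intro z
    rw [Measure.addHaar_closedBall _ _ (by positivity), ENNReal.ofReal_mul (by positivity), ballVolume,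
      ENNReal.ofReal_toReal measure_ball_lt_top.ne]
    simp
  have key := (measure_mono (μ := volume) hsub).trans (measure_biUnion_finset_le _ _)
  simp only [hvol, Finset.sum_const, Finset.card_range, nsmul_eq_mul] at key
  have hb : 0 ≤ ballVolume (n+1) := ENNReal.toReal_nonneg
  calc _ ≤ ((Module.finrank ℝ (EuclideanSpace ℝ (Fin (n+1))) : ℕ) : ℝ≥0∞) * (m * ENNReal.ofReal ((2*ε)^(n+1) * ballVolume (n+1))) := by gcongr
    _ = ENNReal.ofReal ((n+1) * (m * ((2*ε)^(n+1) * ballVolume (n+1)))) := by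
      rw [ENNReal.ofReal_mul (by positivity), ENNReal.ofReal_mul (by positivity)]
      congr 1
      · rw [finrank_euclideanSpace_fin]
        have : ((n:ℝ)+1) = ((n+1 : ℕ) : ℝ) := by push_cast; rfl
        rw [this, ENNReal.ofReal_natCast]
      · rw [ENNReal.ofReal_mul (by positivity), ENNReal.ofReal_natCast, ENNReal.ofReal_mul (by positivity)]
    _ ≤ _ := by
      apply ENNReal.ofReal_le_ofReal
      rw [mul_assoc ((n:ℝ)+1)]
      refine mul_le_mul_of_nonneg_left ?_ (by positivity)
      calc (m:ℝ) * ((2*ε)^(n+1) * ballVolume (n+1)) ≤ (2 * ε⁻¹) * ((2*ε)^(n+1) * (ballVolume (n+1)+1)) := by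
            gcongr; linarith
        _ = _ := by rw [mul_pow, pow_succ ε]; field_simp

lemma toSphere_le (n : ℕ) (hn : 1 ≤ n) : ∃ C : ℝ, 0 < C ∧
    (volume : Measure (EuclideanSpace ℝ (Fin (n+1)))).toSphere ≤ ENNReal.ofReal C • μH[(n:ℝ)] := by
  obtain ⟨C, hC, h⟩ := cone_ball n
  refine ⟨C, hC, ?_⟩
  have hC0 : ENNReal.ofReal C ≠ 0 := by simpa using hC
  have hn0 : n ≠ 0 := by omega
  have key : (ENNReal.ofReal C)⁻¹ • (volume : Measure (EuclideanSpace ℝ (Fin (n+1)))).toSphere ≤ μH[(n:ℝ)] := by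
    apply Measure.le_hausdorffMeasure _ _ 1 one_pos
    intro s hs
    rcases s.eq_empty_or_nonempty with rfl | ⟨x, hx⟩
    · simp
    have hd : ediam s ≠ ⊤ := ne_top_of_le_ne_top ENNReal.one_ne_top hs
    have hbd : Bornology.IsBounded s := isBounded_iff_ediam_ne_top.2 hd
    have hd1 : Metric.diam s ≤ 1 := by
      rw [Metric.diam]; exact ENNReal.toReal_le_of_le_ofReal zero_le_one (by simpa using hs)
    have hsub : ∀ ε, Metric.diam s ≤ ε → s ⊆ closedBall x ε := fun ε he y hy =>
      (dist_le_diam_of_mem hbd hy hx).trans he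
    have e1 : ediam s = ENNReal.ofReal (Metric.diam s) := (ENNReal.ofReal_toReal hd).symm
    have h2 : (volume : Measure (EuclideanSpace ℝ (Fin (n+1)))).toSphere s ≤ ENNReal.ofReal (C * Metric.diam s ^ n) := by
      rcases (Metric.diam_nonneg (s := s)).eq_or_lt with h0 | h0
      · rw [← h0]
        have ht : Filter.Tendsto (fun ε : ℝ => ENNReal.ofReal (C * ε ^ n)) (nhdsWithin 0 (Ioi 0))
            (nhds (ENNReal.ofReal (C * 0 ^ n))) := by
          apply Filter.Tendsto.mono_left _ nhdsWithin_le_nhds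
          exact Continuous.tendsto (ENNReal.continuous_ofReal.comp (by fun_prop)) 0
        refine ge_of_tendsto ht ?_
        filter_upwards [Ioc_mem_nhdsGT (zero_lt_one (α := ℝ))] with ε he
        exact (measure_mono (hsub ε (h0 ▸ he.1.le))).trans (h x ε he.1 he.2)
      · exact (measure_mono (hsub _ le_rfl)).trans (h x _ h0 hd1)
    rw [Measure.smul_apply, smul_eq_mul, e1, ENNReal.rpow_natCast, ← ENNReal.ofReal_pow Metric.diam_nonneg]
    rw [ENNReal.ofReal_mul hC.le] at h2
    calc _ ≤ (ENNReal.ofReal C)⁻¹ * (ENNReal.ofReal C * ENNReal.ofReal (Metric.diam s ^ n)) := by gcongr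
      _ = _ := by rw [← mul_assoc, ENNReal.inv_mul_cancel hC0 ENNReal.ofReal_ne_top, one_mul]
  intro s
  have := key s
  rw [Measure.smul_apply, smul_eq_mul] at this ⊢
  calc _ = ENNReal.ofReal C * ((ENNReal.ofReal C)⁻¹ * (volume : Measure (EuclideanSpace ℝ (Fin (n+1)))).toSphere s) := by
        rw [← mul_assoc, ENNReal.mul_inv_cancel hC0 ENNReal.ofReal_ne_top, one_mul]
    _ ≤ _ := by gcongr

lemma lintegral_sphere_le (n : ℕ) (hn : 1 ≤ n) (r : ℝ) (hr : 0 < r) : ∃ C : ℝ, 0 < C ∧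
    ∀ g : EuclideanSpace ℝ (Fin (n+1)) → ℝ≥0∞,
      ∫⁻ x, g (r • (x : EuclideanSpace ℝ (Fin (n+1)))) ∂(volume : Measure (EuclideanSpace ℝ (Fin (n+1)))).toSphere
        ≤ ENNReal.ofReal C * ∫⁻ x in sphere 0 r, g x ∂μH[(n:ℝ)] := by
  obtain ⟨C, hC, h⟩ := toSphere_le n hn
  set φ : sphere (0 : EuclideanSpace ℝ (Fin (n+1))) 1 → EuclideanSpace ℝ (Fin (n+1)) :=
    fun x => r • (x : EuclideanSpace ℝ (Fin (n+1))) with hφ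
  have hcont : Continuous φ := by fun_prop
  have hinj : Function.Injective φ := by
    intro x y hxy
    exact Subtype.ext (smul_right_injective _ hr.ne' hxy)
  have hemb : MeasurableEmbedding φ := (hcont.isClosedEmbedding hinj).measurableEmbedding
  have hanti : AntilipschitzWith (r⁻¹).toNNReal φ := by
    apply AntilipschitzWith.of_le_mul_dist
    intro x y
    rw [Real.coe_toNNReal _ (by positivity), Subtype.dist_eq, dist_smul₀, Real.norm_eq_abs, abs_of_pos hr]
    rw [← mul_assoc, inv_mul_cancel₀ hr.ne', one_mul]
  have hle : Measure.map φ (volume : Measure (EuclideanSpace ℝ (Fin (n+1)))).toSphere ≤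
      ENNReal.ofReal (C * (r⁻¹)^n) • (μH[(n:ℝ)].restrict (sphere 0 r)) := by
    rw [Measure.le_iff]
    intro A hA
    rw [hemb.map_apply, Measure.smul_apply, Measure.restrict_apply hA, smul_eq_mul,
      ENNReal.ofReal_mul hC.le, mul_assoc]
    have hpre : φ ⁻¹' A = φ ⁻¹' (A ∩ sphere 0 r) := by
      ext x
      have : φ x ∈ sphere (0 : EuclideanSpace ℝ (Fin (n+1))) r := by
        simp [hφ, norm_smul, abs_of_pos hr]
      simp only [mem_preimage, mem_inter_iff, this, and_true]
    refine (h _).trans ?_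
    rw [Measure.smul_apply, smul_eq_mul, hpre]
    gcongr
    refine (hanti.hausdorffMeasure_preimage_le (Nat.cast_nonneg n) _).trans (le_of_eq ?_)
    rw [ENNReal.rpow_natCast, ENNReal.ofReal_pow (by positivity)]
    rfl
  refine ⟨C * (r⁻¹)^n, by positivity, fun g => ?_⟩
  rw [← hemb.lintegral_map]
  refine (lintegral_mono' hle le_rfl).trans ?_
  rw [lintegral_smul_measure, smul_eq_mul]

lemma volumeIoiPow_bound (n : ℕ) (a b M : ℝ) (hb : a ≤ M) (hb' : b ≤ M) :
    Measure.volumeIoiPow n (Subtype.val ⁻¹' (uIcc a b)) ≤ ENNReal.ofReal (M ^ n * |a - b|) := by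
  rcases lt_or_ge M 0 with hM | hM
  · have : (Subtype.val ⁻¹' (uIcc a b) : Set (Ioi (0:ℝ))) = ∅ := by
      ext ⟨s, hs⟩
      simp only [mem_preimage, mem_empty_iff_false, iff_false]
      intro h
      have := h.2.trans (max_le hb hb')
      have := mem_Ioi.1 hs
      linarith
    simp [this]
  have hms : MeasurableSet (Subtype.val ⁻¹' (uIcc a b) : Set (Ioi (0:ℝ))) :=
    measurable_subtype_coe measurableSet_uIcc
  rw [Measure.volumeIoiPow, withDensity_apply _ hms]
  calc _ ≤ ∫⁻ s in (Subtype.val ⁻¹' (uIcc a b) : Set (Ioi (0:ℝ))), ENNReal.ofReal (M^n)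
        ∂(Measure.comap Subtype.val volume) := by
        apply setLIntegral_mono measurable_const
        intro s hs
        apply ENNReal.ofReal_le_ofReal
        exact pow_le_pow_left₀ (le_of_lt s.2) (hs.2.trans (max_le hb hb')) n
    _ = ENNReal.ofReal (M^n) * (Measure.comap Subtype.val volume) (Subtype.val ⁻¹' (uIcc a b) : Set (Ioi (0:ℝ))) := by
        rw [setLIntegral_const]
    _ ≤ ENNReal.ofReal (M^n) * ENNReal.ofReal |a - b| := by
        gcongr
        rw [comap_subtype_coe_apply measurableSet_Ioi]
        refine (measure_mono (image_preimage_subset _ _)).trans ?_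
        rw [Real.volume_interval, abs_sub_comm]
    _ = _ := by rw [ENNReal.ofReal_mul (by positivity)]

lemma smul_mem_radSet (N : ℕ) (m : ℝ) (hr : 0 < rad N m) (f : EuclideanSpace ℝ (Fin N) → ℝ)
    (x : EuclideanSpace ℝ (Fin N)) (hx : ‖x‖ = 1) (s : ℝ) (hs : 0 < s) :
    s • x ∈ radSet N m f ↔ s ≤ rad N m * (1 + f (rad N m • x)) := by
  constructor
  · rintro ⟨y, hy, t, ht, htf, he⟩
    rw [mem_sphere_zero_iff_norm] at hy
    have h1 : s = t * rad N m := by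
      have := congrArg norm he
      rwa [norm_smul, norm_smul, hx, hy, Real.norm_eq_abs, Real.norm_eq_abs, abs_of_pos hs,
        abs_of_nonneg ht, mul_one] at this
    have ht0 : t ≠ 0 := by rintro rfl; simp at h1; exact hs.ne' h1
    have h2 : rad N m • x = y := by
      rw [h1, mul_smul] at he
      exact smul_right_injective _ ht0 he
    rw [h2, h1, mul_comm]
    gcongr
  · intro h
    refine ⟨rad N m • x, by simp [norm_smul, hx, abs_of_pos hr], s / rad N m, by positivity, ?_, ?_⟩
    · rw [div_le_iff₀ hr, mul_comm]; exact h
    · rw [smul_smul, div_mul_cancel₀ _ hr.ne']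

lemma isCompact_radSet (N : ℕ) (m : ℝ) (f : EuclideanSpace ℝ (Fin N) → ℝ)
    (hf : ContinuousOn f (sphere (0 : EuclideanSpace ℝ (Fin N)) (rad N m)))
    (hb : ∀ x ∈ sphere (0 : EuclideanSpace ℝ (Fin N)) (rad N m), |f x| ≤ 1 / 2) :
    IsCompact (radSet N m f) := by
  have : radSet N m f = (fun p : EuclideanSpace ℝ (Fin N) × ℝ => (p.2 * (1 + f p.1)) • p.1) ''
      (sphere 0 (rad N m) ×ˢ Icc 0 1) := by
    ext y
    constructor
    · rintro ⟨x, hx, t, ht, htf, rfl⟩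
      have := abs_le.1 (hb x hx)
      have hp : 0 < 1 + f x := by linarith
      refine ⟨(x, t / (1 + f x)), ⟨hx, by positivity, (div_le_one hp).2 htf⟩, ?_⟩
      simp only
      rw [div_mul_cancel₀ _ hp.ne']
    · rintro ⟨⟨x, t⟩, ⟨hx, ht⟩, rfl⟩
      have := abs_le.1 (hb x hx)
      have hp : 0 < 1 + f x := by linarith
      exact ⟨x, hx, t * (1 + f x), mul_nonneg ht.1 hp.le, mul_le_of_le_one_left hp.le ht.2, rfl⟩
  rw [this]
  refine ((isCompact_sphere _ _).prod isCompact_Icc).image_of_continuousOn ?_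
  have h1 : ContinuousOn (fun p : EuclideanSpace ℝ (Fin N) × ℝ => f p.1) (sphere 0 (rad N m) ×ˢ Icc 0 1) :=
    hf.comp continuousOn_fst (fun p hp => hp.1)
  exact (continuousOn_snd.mul (continuousOn_const.add h1)).smul continuousOn_fst

lemma vol_symmDiff_le (n : ℕ) (m : ℝ) (hr : 0 < rad (n+1) m)
    (f₁ f₂ : EuclideanSpace ℝ (Fin (n+1)) → ℝ)
    (hf₁ : ContinuousOn f₁ (sphere (0 : EuclideanSpace ℝ (Fin (n+1))) (rad (n+1) m)))
    (hf₂ : ContinuousOn f₂ (sphere (0 : EuclideanSpace ℝ (Fin (n+1))) (rad (n+1) m)))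
    (hb₁ : ∀ x ∈ sphere (0 : EuclideanSpace ℝ (Fin (n+1))) (rad (n+1) m), |f₁ x| ≤ 1 / 2)
    (hb₂ : ∀ x ∈ sphere (0 : EuclideanSpace ℝ (Fin (n+1))) (rad (n+1) m), |f₂ x| ≤ 1 / 2) :
    volume (symmDiff (radSet (n+1) m f₁) (radSet (n+1) m f₂)) ≤
      ENNReal.ofReal ((rad (n+1) m * (3/2)) ^ n * rad (n+1) m) *
      ∫⁻ x, ENNReal.ofReal |f₁ (rad (n+1) m • (x : EuclideanSpace ℝ (Fin (n+1)))) -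
        f₂ (rad (n+1) m • (x : EuclideanSpace ℝ (Fin (n+1))))|
        ∂(volume : Measure (EuclideanSpace ℝ (Fin (n+1)))).toSphere := by
  set r := rad (n+1) m with hrdef
  set D := symmDiff (radSet (n+1) m f₁) (radSet (n+1) m f₂) with hD
  have hDm : MeasurableSet D := (isCompact_radSet _ m f₁ hf₁ hb₁).measurableSet.symmDiff
    (isCompact_radSet _ m f₂ hf₂ hb₂).measurableSet
  have h0 : ∀ f : EuclideanSpace ℝ (Fin (n+1)) → ℝ,
      (∀ x ∈ sphere (0 : EuclideanSpace ℝ (Fin (n+1))) (rad (n+1) m), |f x| ≤ 1 / 2) →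
      (0 : EuclideanSpace ℝ (Fin (n+1))) ∈ radSet (n+1) m f := by
    intro f hf
    obtain ⟨v, hv⟩ : ∃ v : EuclideanSpace ℝ (Fin (n+1)), ‖v‖ = rad (n+1) m := exists_norm_eq _ hr.le
    have hv' : v ∈ sphere (0 : EuclideanSpace ℝ (Fin (n+1))) (rad (n+1) m) := by simpa using hv
    have := abs_le.1 (hf v hv')
    exact ⟨v, hv', 0, le_rfl, by linarith, by simp⟩
  have hD0 : D ⊆ {0}ᶜ := by
    rintro y hy rfl
    rcases hy with hy | hy
    · exact hy.2 (h0 f₂ hb₂)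
    · exact hy.2 (h0 f₁ hb₁)
  have hmp := (volume : Measure (EuclideanSpace ℝ (Fin (n+1)))).measurePreserving_homeomorphUnitSphereProd
  rw [finrank_euclideanSpace_fin, Nat.add_sub_cancel] at hmp
  set H := homeomorphUnitSphereProd (EuclideanSpace ℝ (Fin (n+1))) with hH
  set T : Set (sphere (0 : EuclideanSpace ℝ (Fin (n+1))) 1 × Ioi (0:ℝ)) :=
    H.symm ⁻¹' (Subtype.val ⁻¹' D) with hT
  have hTm : MeasurableSet T := H.symm.measurable (measurable_subtype_coe hDm)
  have e1 : volume D = ((volume : Measure (EuclideanSpace ℝ (Fin (n+1)))).toSphere.prod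
      (Measure.volumeIoiPow n)) T := by
    rw [← hmp.measure_preimage hTm.nullMeasurableSet]
    have : H ⁻¹' T = Subtype.val ⁻¹' D := by
      ext y; simp [hT]
    rw [this, comap_subtype_coe_apply (measurableSet_singleton _).compl, Subtype.image_preimage_coe,
      inter_eq_right.2 hD0]
  rw [e1, Measure.prod_apply hTm, ← lintegral_const_mul' _ _ ENNReal.ofReal_ne_top]
  apply lintegral_mono
  intro x
  have hx : ‖(x : EuclideanSpace ℝ (Fin (n+1)))‖ = 1 := by simp
  have hrx : r • (x : EuclideanSpace ℝ (Fin (n+1))) ∈ sphere (0 : EuclideanSpace ℝ (Fin (n+1))) r := by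
    simp [norm_smul, abs_of_pos hr]
  have hsub : Prod.mk x ⁻¹' T ⊆ Subtype.val ⁻¹' (uIcc (r * (1 + f₁ (r • (x : EuclideanSpace ℝ (Fin (n+1))))))
      (r * (1 + f₂ (r • (x : EuclideanSpace ℝ (Fin (n+1))))))) := by
    intro s hs
    have hs' : (s : ℝ) • (x : EuclideanSpace ℝ (Fin (n+1))) ∈ D := hs
    have m1 := smul_mem_radSet (n+1) m hr f₁ x hx s s.2
    have m2 := smul_mem_radSet (n+1) m hr f₂ x hx s s.2
    rw [mem_preimage, mem_uIcc]
    rcases hs' with ⟨ha, hb⟩ | ⟨ha, hb⟩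
    · rw [m2, not_le] at hb
      exact Or.inr ⟨hb.le, m1.1 ha⟩
    · rw [m1, not_le] at hb
      exact Or.inl ⟨hb.le, m2.1 ha⟩
  refine (measure_mono hsub).trans ((volumeIoiPow_bound n _ _ (r * (3/2)) ?_ ?_).trans (le_of_eq ?_))
  · have := abs_le.1 (hb₁ _ hrx); gcongr; linarith
  · have := abs_le.1 (hb₂ _ hrx); gcongr; linarith
  · simp only
    rw [← ENNReal.ofReal_mul (by positivity)]
    congr 1
    rw [← mul_sub, abs_mul, abs_of_pos hr, mul_assoc]
    congr 3
    ring

/-- Step 2 of the proof of Lemma 3.6: the distance between the barycenters of two radial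
graphs is controlled by the `L²` distance of the parametrizing functions. -/
theorem barycenter_controlled_by_L2_distance
    (N : ℕ) (hN : 2 ≤ N) (μ : ℝ) (hμ : 0 < μ) :
    ∃ C : ℝ, 0 < C ∧
      ∀ f₁ f₂ : EuclideanSpace ℝ (Fin N) → ℝ,
        ContinuousOn f₁ (sphere (0 : EuclideanSpace ℝ (Fin N)) (rad N μ)) →
        ContinuousOn f₂ (sphere (0 : EuclideanSpace ℝ (Fin N)) (rad N μ)) →
        (∀ x ∈ sphere (0 : EuclideanSpace ℝ (Fin N)) (rad N μ), |f₁ x| ≤ 1 / 2) →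
        (∀ x ∈ sphere (0 : EuclideanSpace ℝ (Fin N)) (rad N μ), |f₂ x| ≤ 1 / 2) →
        volume (radSet N μ f₁) = ENNReal.ofReal μ →
        volume (radSet N μ f₂) = ENNReal.ofReal μ →
        ‖bary N (radSet N μ f₁) - bary N (radSet N μ f₂)‖ ≤
          C * Real.sqrt (∫ x in sphere (0 : EuclideanSpace ℝ (Fin N)) (rad N μ),
            (f₁ x - f₂ x) ^ 2 ∂μH[(N : ℝ) - 1]) := by
  obtain ⟨n, rfl⟩ : ∃ n, N = n + 1 := ⟨N - 1, by omega⟩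
  have hn : 1 ≤ n := by omega
  have hexp : ((n + 1 : ℕ) : ℝ) - 1 = n := by push_cast; ring
  rw [hexp]
  have hbv : 0 < ballVolume (n+1) :=
    ENNReal.toReal_pos (measure_ball_pos _ _ one_pos).ne' measure_ball_lt_top.ne
  have hr : 0 < rad (n+1) μ := Real.rpow_pos_of_pos (div_pos hμ hbv) _
  obtain ⟨C, hC, hle⟩ := lintegral_sphere_le n hn (rad (n+1) μ) hr
  set r := rad (n+1) μ with hrdef
  set S := sphere (0 : EuclideanSpace ℝ (Fin (n+1))) r with hS
  set ν : Measure (EuclideanSpace ℝ (Fin (n+1))) := μH[(n:ℝ)].restrict S with hν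
  have : IsFiniteMeasure ν := ⟨by rw [hν, Measure.restrict_apply_univ]; exact sphere_fin n r⟩
  set c := (r * (3/2)) ^ n * r with hc
  have hc0 : 0 < c := by positivity
  refine ⟨μ⁻¹ * (r * (3/2) * (c * (C * (Real.sqrt (ν.real univ) + 1)))), by positivity, ?_⟩
  intro f₁ f₂ hf₁ hf₂ hb₁ hb₂ hv₁ hv₂
  have hg : AEStronglyMeasurable (fun x => f₁ x - f₂ x) ν :=
    (hf₁.sub hf₂).aestronglyMeasurable isClosed_sphere.measurableSet
  have hgb : ∀ᵐ x ∂ν, ‖f₁ x - f₂ x‖ ≤ 1 := by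
    filter_upwards [ae_restrict_mem isClosed_sphere.measurableSet] with x hx
    have h1 := abs_le.1 (hb₁ x hx)
    have h2 := abs_le.1 (hb₂ x hx)
    rw [Real.norm_eq_abs, abs_le]
    constructor <;> linarith
  have hint : Integrable (fun x => |f₁ x - f₂ x|) ν := (Integrable.of_bound hg 1 hgb).abs
  have hCS : ∫ x, |f₁ x - f₂ x| ∂ν ≤ Real.sqrt (ν.real univ) * Real.sqrt (∫ x, (f₁ x - f₂ x)^2 ∂ν) := by
    have := integral_mul_le_Lp_mul_Lq_of_nonneg (μ := ν) Real.HolderConjugate.two_two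
      (f := fun _ => 1) (g := fun x => |f₁ x - f₂ x|)
      (Filter.Eventually.of_forall fun _ => zero_le_one) (Filter.Eventually.of_forall fun _ => abs_nonneg _)
      (memLp_const 1) (MemLp.of_bound hg 1 hgb).abs
    simpa [Real.sqrt_eq_rpow] using this
  have hvol := (vol_symmDiff_le n μ hr f₁ f₂ hf₁ hf₂ hb₁ hb₂).trans
    (mul_le_mul_right (hle fun x => ENNReal.ofReal |f₁ x - f₂ x|) _)
  set D := symmDiff (radSet (n+1) μ f₁) (radSet (n+1) μ f₂) with hD
  have hE₁ := isCompact_radSet _ μ f₁ hf₁ hb₁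
  have hE₂ := isCompact_radSet _ μ f₂ hf₂ hb₂
  have hDm : MeasurableSet D := hE₁.measurableSet.symmDiff hE₂.measurableSet
  have hI0 : 0 ≤ ∫ x, |f₁ x - f₂ x| ∂ν := integral_nonneg fun _ => abs_nonneg _
  rw [← ofReal_integral_eq_lintegral_ofReal hint (Filter.Eventually.of_forall fun _ => abs_nonneg _),
    ← ENNReal.ofReal_mul hC.le, ← ENNReal.ofReal_mul hc0.le] at hvol
  have hDfin : volume D ≠ ⊤ := ne_top_of_le_ne_top ENNReal.ofReal_ne_top hvol
  have hvol' : volume.real D ≤ c * (C * ∫ x, |f₁ x - f₂ x| ∂ν) :=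
    ENNReal.toReal_le_of_le_ofReal (by positivity) hvol
  have hnorm : ∀ f : EuclideanSpace ℝ (Fin (n+1)) → ℝ, (∀ x ∈ S, |f x| ≤ 1 / 2) →
      ∀ y ∈ radSet (n+1) μ f, ‖y‖ ≤ r * (3/2) := by
    rintro f hf y ⟨x, hx, t, ht, htf, rfl⟩
    have h1 := abs_le.1 (hf x hx)
    rw [mem_sphere_zero_iff_norm] at hx
    rw [norm_smul, hx, Real.norm_eq_abs, abs_of_nonneg ht, mul_comm]
    refine mul_le_mul_of_nonneg_left ?_ hr.le
    linarith
  have hid : ∀ E : Set (EuclideanSpace ℝ (Fin (n+1))), IsCompact E →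
      Integrable (E.indicator fun x => x) volume := fun E hE =>
    (continuous_id.continuousOn.integrableOn_compact hE).integrable_indicator hE.measurableSet
  have hmain : ‖(∫ x in radSet (n+1) μ f₁, x) - ∫ x in radSet (n+1) μ f₂, x‖ ≤ r * (3/2) * volume.real D := by
    rw [← integral_indicator hE₁.measurableSet, ← integral_indicator hE₂.measurableSet,
      ← integral_sub (hid _ hE₁) (hid _ hE₂)]
    have : r * (3/2) * volume.real D = ∫ x, D.indicator (fun _ => r * (3/2)) x := by
      rw [integral_indicator hDm, setIntegral_const, smul_eq_mul, mul_comm]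
    rw [this]
    apply norm_integral_le_of_norm_le
    · exact (integrable_indicator_iff hDm).2 (integrableOn_const hDfin)
    · refine Filter.Eventually.of_forall fun y => ?_
      by_cases h1 : y ∈ radSet (n+1) μ f₁ <;> by_cases h2 : y ∈ radSet (n+1) μ f₂
      · simp [h1, h2, hD, mem_symmDiff]
      · simpa [h1, h2, hD, mem_symmDiff] using hnorm f₁ hb₁ y h1
      · simpa [h1, h2, hD, mem_symmDiff] using hnorm f₂ hb₂ y h2
      · simp [h1, h2, hD, mem_symmDiff]
  rw [bary, bary, hv₁, hv₂, ENNReal.toReal_ofReal hμ.le, ← smul_sub, norm_smul, Real.norm_eq_abs,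
    abs_of_pos (inv_pos.2 hμ)]
  have hs0 := Real.sqrt_nonneg (∫ x, (f₁ x - f₂ x)^2 ∂ν)
  calc _ ≤ μ⁻¹ * (r * (3/2) * (c * (C * ((Real.sqrt (ν.real univ) + 1) * Real.sqrt (∫ x, (f₁ x - f₂ x)^2 ∂ν))))) := by
        gcongr
        refine hmain.trans ?_
        gcongr
        refine hvol'.trans ?_
        gcongr
        refine hCS.trans ?_
        gcongr
        linarith
    _ = _ := by ring
end
end
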